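/- arXiv:0902.4495 — 3 statements merged into one kernel-verified Lean document; each statement's English description precedes it below -/
import Mathlib

section
/- Let P be a Markov transition kernel on a Polish space X with metric d, and suppose P admits two ergodic invariant probability measures μ₁ and μ₂. Then the following three statements are equivalent: (1) μ₁ = μ₂; (2) there exists a coupling Γ ∈ C(P_[∞]μ₁, P_[∞]μ₂) with Γ(D) = 1; (3) there exists Γ ∈ C̃(P_[∞]μ₁, P_[∞]μ₂) with Γ(D) > 0. -/
open MeasureTheory ProbabilityTheory Filter Topology
open scoped ENNReal NNReal

noncomputable section

/-- A coupling of two measures: a measure on the product with the given marginals. -/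
def IsCoupling {α β : Type*} [MeasurableSpace α] [MeasurableSpace β]
    (π : Measure (α × β)) (μ : Measure α) (ν : Measure β) : Prop :=
  π.map Prod.fst = μ ∧ π.map Prod.snd = ν

/-- `m` is the law on the sequence space of the Markov chain with transition kernel `P`
and initial distribution `μ` (i.e. `P_[∞] μ`), characterised through its
finite-dimensional distributions. -/
def IsTrajLaw {Y : Type*} [MeasurableSpace Y] (P : Kernel Y Y) (μ : Measure Y)
    (m : Measure (ℕ → Y)) : Prop :=
  IsProbabilityMeasure m ∧
  m.map (fun ω => ω 0) = μ ∧
  ∀ n : ℕ, m.map (fun ω => ((fun i : Fin (n + 1) => ω i), ω (n + 1))) =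
    (m.map (fun ω => (fun i : Fin (n + 1) => ω i))).bind
      (fun v => (P (v (Fin.last n))).map (fun y => (v, y)))

/-- The diagonal at infinity: pairs of sequences that converge to each other. -/
def diagInf (X : Type*) [PseudoMetricSpace X] : Set ((ℕ → X) × (ℕ → X)) :=
  {p | Tendsto (fun n => dist (p.1 n) (p.2 n)) atTop (nhds 0)}

/-- `μ` is an ergodic invariant probability measure for the Markov kernel `P`:
it is invariant, and every bounded measurable `P`-invariant (μ-a.e.) function is
μ-a.s. constant. -/
def IsErgodicInvariant {Y : Type*} [MeasurableSpace Y] (P : Kernel Y Y) (μ : Measure Y) :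
    Prop :=
  μ.bind (fun x => P x) = μ ∧
  ∀ φ : Y → ℝ, Measurable φ → (∃ M, ∀ x, |φ x| ≤ M) →
    (∀ᵐ x ∂μ, ∫ y, φ y ∂(P x) = φ x) → ∃ c : ℝ, ∀ᵐ x ∂μ, φ x = c

section MarkovOp

variable {Y : Type*} [MeasurableSpace Y]

/-- The action of a kernel on real functions, `f ↦ ∫ f(y) P(·, dy)`. -/
def markovOp (P : Kernel Y Y) (f : Y → ℝ) : Y → ℝ := fun x => ∫ y, f y ∂(P x)

lemma measurable_markovOp (P : Kernel Y Y) [IsMarkovKernel P] {f : Y → ℝ} (hf : Measurable f) :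
    Measurable (markovOp P f) :=
  (StronglyMeasurable.integral_kernel_prod_right' (κ := P) (f := fun p : Y × Y => f p.2)
    (hf.comp measurable_snd).stronglyMeasurable).measurable

lemma abs_markovOp_le (P : Kernel Y Y) [IsMarkovKernel P] {f : Y → ℝ} {M : ℝ}
    (hM : ∀ x, |f x| ≤ M) (x : Y) : |markovOp P f x| ≤ M := by
  have h := norm_integral_le_of_norm_le_const (μ := P x) (f := f) (C := M)
    (Eventually.of_forall hM)
  simpa [markovOp] using h

lemma measurable_markovOp_iterate (P : Kernel Y Y) [IsMarkovKernel P] {f : Y → ℝ}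
    (hf : Measurable f) (n : ℕ) : Measurable ((markovOp P)^[n] f) := by
  induction n with
  | zero => exact hf
  | succ n ih =>
    rw [Function.iterate_succ_apply']
    exact measurable_markovOp P ih

lemma abs_markovOp_iterate_le (P : Kernel Y Y) [IsMarkovKernel P] {f : Y → ℝ} {M : ℝ}
    (hM : ∀ x, |f x| ≤ M) (n : ℕ) (x : Y) : |(markovOp P)^[n] f x| ≤ M := by
  induction n generalizing x with
  | zero => exact hM x
  | succ n ih =>
    rw [Function.iterate_succ_apply']
    exact abs_markovOp_le P ih x

lemma integral_markovOp (P : Kernel Y Y) [IsMarkovKernel P] {μ : Measure Y}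
    [IsProbabilityMeasure μ] (hμ : μ.bind (fun x => P x) = μ) {f : Y → ℝ} {M : ℝ}
    (hf : Measurable f) (hM : ∀ x, |f x| ≤ M) : ∫ x, markovOp P f x ∂μ = ∫ x, f x ∂μ := by
  have hi : Integrable (fun p : Y × Y => f p.2) (μ ⊗ₘ P) :=
    .of_bound (hf.comp measurable_snd).aestronglyMeasurable M (Eventually.of_forall fun p => hM p.2)
  have hs : (μ ⊗ₘ P).map Prod.snd = μ := (Measure.snd_compProd μ P).trans hμ
  have h := Measure.integral_compProd hi
  rw [← integral_map (f := f) measurable_snd.aemeasurable hf.aestronglyMeasurable, hs] at h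
  exact h.symm

lemma integral_markovOp_iterate (P : Kernel Y Y) [IsMarkovKernel P] {μ : Measure Y}
    [IsProbabilityMeasure μ] (hμ : μ.bind (fun x => P x) = μ) {f : Y → ℝ} {M : ℝ}
    (hf : Measurable f) (hM : ∀ x, |f x| ≤ M) (n : ℕ) :
    ∫ x, (markovOp P)^[n] f x ∂μ = ∫ x, f x ∂μ := by
  induction n with
  | zero => rfl
  | succ n ih =>
    rw [Function.iterate_succ_apply', integral_markovOp P hμ (measurable_markovOp_iterate P hf n)
      (abs_markovOp_iterate_le P hM n), ih]

lemma memLp_of_abs_le {Ω : Type*} [MeasurableSpace Ω] {μ : Measure Ω} [IsFiniteMeasure μ]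
    {f : Ω → ℝ} {M : ℝ} (hf : Measurable f) (hM : ∀ x, |f x| ≤ M) : MemLp f 2 μ :=
  .of_bound hf.aestronglyMeasurable M (Eventually.of_forall hM)

lemma inner_toLp_eq_integral {Ω : Type*} [MeasurableSpace Ω] {μ : Measure Ω}
    {f g : Ω → ℝ} (hf : MemLp f 2 μ) (hg : MemLp g 2 μ) :
    inner ℝ (hf.toLp f) (hg.toLp g) = ∫ x, f x * g x ∂μ := by
  rw [L2.inner_def]
  refine integral_congr_ae ?_
  filter_upwards [hf.coeFn_toLp, hg.coeFn_toLp] with x h1 h2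
  rw [h1, h2, real_inner_eq_re_inner, RCLike.inner_apply]
  simp [mul_comm]

/-- A Markov kernel induces a contraction of `L²` of an invariant measure. -/
lemma exists_contraction_markovOp (P : Kernel Y Y) [IsMarkovKernel P] {μ : Measure Y}
    [IsProbabilityMeasure μ] (hμ : μ.bind (fun x => P x) = μ) :
    ∃ T : Lp ℝ 2 μ →L[ℝ] Lp ℝ 2 μ, ‖T‖ ≤ 1 ∧
      ∀ (f : Y → ℝ) (M : ℝ) (hf : Measurable f) (hM : ∀ x, |f x| ≤ M),
        T ((memLp_of_abs_le hf hM).toLp f) =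
          (memLp_of_abs_le (measurable_markovOp P hf) (abs_markovOp_le P hM)).toLp
            (markovOp P f) := by
  have h1 : MeasurePreserving Prod.fst (μ ⊗ₘ P) μ := ⟨measurable_fst, Measure.fst_compProd μ P⟩
  have h2 : MeasurePreserving Prod.snd (μ ⊗ₘ P) μ :=
    ⟨measurable_snd, (Measure.snd_compProd μ P).trans hμ⟩
  let U := Lp.compMeasurePreservingₗᵢ (E := ℝ) (p := 2) ℝ Prod.fst h1
  let V := Lp.compMeasurePreservingₗᵢ (E := ℝ) (p := 2) ℝ Prod.snd h2
  refine ⟨U.toContinuousLinearMap.adjoint ∘L V.toContinuousLinearMap, ?_, ?_⟩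
  · refine (ContinuousLinearMap.opNorm_comp_le _ _).trans ?_
    rw [LinearIsometryEquiv.norm_map]
    exact mul_le_one₀ U.norm_toContinuousLinearMap_le (norm_nonneg _)
      V.norm_toContinuousLinearMap_le
  · intro f M hf hM
    refine ext_inner_left ℝ fun g => ?_
    obtain ⟨g, hg, rfl⟩ : ∃ (g' : Y → ℝ) (hg : MemLp g' 2 μ), hg.toLp g' = g :=
      ⟨g, Lp.memLp g, Lp.toLp_coeFn g _⟩
    rw [ContinuousLinearMap.comp_apply, ContinuousLinearMap.adjoint_inner_right,
      inner_toLp_eq_integral]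
    have hgm := hg.comp_measurePreserving h1
    have hfm := (memLp_of_abs_le hf hM).comp_measurePreserving h2
    have : inner ℝ (U (hg.toLp g)) (V ((memLp_of_abs_le hf hM).toLp f)) =
        ∫ p, (g ∘ Prod.fst) p * (f ∘ Prod.snd) p ∂(μ ⊗ₘ P) :=
      inner_toLp_eq_integral hgm hfm
    refine this.trans ?_
    refine (Measure.integral_compProd (hgm.integrable_mul hfm)).trans ?_
    simp only [Pi.mul_apply, Function.comp_apply, markovOp, integral_const_mul]

end MarkovOp

section MeanErgodic

variable {Y : Type*} [MeasurableSpace Y]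

/-- An `L²` limit of measurable functions with values in `[-M, M]` is represented by such a
function. -/
lemma exists_bounded_toLp_eq_of_tendsto {μ : Measure Y} [IsFiniteMeasure μ] {M : ℝ}
    {F : ℕ → Y → ℝ} (hF : ∀ n, Measurable (F n)) (hM : ∀ n x, |F n x| ≤ M) {g : Lp ℝ 2 μ}
    (hg : Tendsto (fun n => (memLp_of_abs_le (hF n) (hM n)).toLp (F n)) atTop (𝓝 g)) :
    ∃ (g' : Y → ℝ) (hg' : Measurable g') (hgM : ∀ x, |g' x| ≤ M),
      (memLp_of_abs_le hg' hgM).toLp g' = g := by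
  obtain ⟨ns, -, hns⟩ := (tendstoInMeasure_of_tendsto_Lp hg).exists_seq_tendsto_ae
  have hbound : ∀ᵐ x ∂μ, |g x| ≤ M := by
    have hF' : ∀ᵐ x ∂μ, ∀ n, (memLp_of_abs_le (hF n) (hM n)).toLp (F n) x = F n x :=
      ae_all_iff.2 fun n => (memLp_of_abs_le (hF n) (hM n)).coeFn_toLp
    filter_upwards [hns, hF'] with x hx hFx
    refine le_of_tendsto hx.abs (Eventually.of_forall fun n => ?_)
    rw [hFx]
    exact hM _ x
  have hgm : Measurable (g : Y → ℝ) := (Lp.stronglyMeasurable g).measurable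
  by_cases hY : Nonempty Y
  · have hM0 : 0 ≤ M := (abs_nonneg _).trans (hM 0 hY.some)
    refine ⟨fun x => max (-M) (min M (g x)), by fun_prop, fun x => ?_, ?_⟩
    · exact abs_le.2 ⟨le_max_left _ _, max_le (by linarith) (min_le_left _ _)⟩
    · refine Lp.ext ((MemLp.coeFn_toLp _).trans ?_)
      filter_upwards [hbound] with x hx
      rw [abs_le] at hx
      rw [min_eq_right hx.2, max_eq_right hx.1]
  · have := not_nonempty_iff.1 hY
    exact ⟨g, hgm, fun x => isEmptyElim x, Lp.toLp_coeFn g _⟩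

lemma iterate_toLp_markovOp {P : Kernel Y Y} [IsMarkovKernel P] {μ : Measure Y}
    [IsProbabilityMeasure μ] {T : Lp ℝ 2 μ →L[ℝ] Lp ℝ 2 μ}
    (hT : ∀ (f : Y → ℝ) (M : ℝ) (hf : Measurable f) (hM : ∀ x, |f x| ≤ M),
        T ((memLp_of_abs_le hf hM).toLp f) =
          (memLp_of_abs_le (measurable_markovOp P hf) (abs_markovOp_le P hM)).toLp
            (markovOp P f))
    {f : Y → ℝ} {M : ℝ} (hf : Measurable f) (hM : ∀ x, |f x| ≤ M) (n : ℕ) :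
    T^[n] ((memLp_of_abs_le hf hM).toLp f) =
      (memLp_of_abs_le (measurable_markovOp_iterate P hf n)
        (abs_markovOp_iterate_le P hM n)).toLp ((markovOp P)^[n] f) := by
  induction n with
  | zero => rfl
  | succ n ih =>
    rw [Function.iterate_succ_apply', ih,
      hT _ M (measurable_markovOp_iterate P hf n) (abs_markovOp_iterate_le P hM n)]
    simp only [Function.iterate_succ_apply']

lemma abs_average_le {M : ℝ} {a : ℕ → ℝ} (ha : ∀ n, |a n| ≤ M) (n : ℕ) :
    |(n : ℝ)⁻¹ * ∑ i ∈ Finset.range n, a i| ≤ M := by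
  have hM : 0 ≤ M := (abs_nonneg _).trans (ha 0)
  rcases Nat.eq_zero_or_pos n with rfl | hn
  · simpa using hM
  · have hn' : (0 : ℝ) < n := by exact_mod_cast hn
    rw [abs_mul, abs_of_pos (inv_pos.2 hn'), inv_mul_le_iff₀ hn']
    refine (Finset.abs_sum_le_sum_abs _ _).trans ?_
    simpa using Finset.sum_le_card_nsmul (Finset.range n) (fun i => |a i|) M fun i _ => ha i

/-- Decay of the averaged autocorrelations of a centred observable under an ergodic invariant
measure. -/
lemma tendsto_average_integral_mul_markovOp {P : Kernel Y Y} [IsMarkovKernel P] {μ : Measure Y}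
    [IsProbabilityMeasure μ] (h : IsErgodicInvariant P μ) {f : Y → ℝ} {M : ℝ}
    (hf : Measurable f) (hM : ∀ x, |f x| ≤ M) (h0 : ∫ x, f x ∂μ = 0) :
    Tendsto (fun n : ℕ => (n : ℝ)⁻¹ *
      ∑ i ∈ Finset.range n, ∫ x, f x * (markovOp P)^[i] f x ∂μ) atTop (𝓝 0) := by
  obtain ⟨hμ, herg⟩ := h
  obtain ⟨T, hT1, hT⟩ := exists_contraction_markovOp P hμ
  have hQm := measurable_markovOp_iterate P hf
  have hQM := abs_markovOp_iterate_le P hM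
  have hQi (i : ℕ) : Integrable ((markovOp P)^[i] f) μ :=
    (memLp_of_abs_le (hQm i) (hQM i)).integrable one_le_two
  let A : ℕ → Y → ℝ := fun n x => (n : ℝ)⁻¹ * ∑ i ∈ Finset.range n, (markovOp P)^[i] f x
  have hAm (n : ℕ) : Measurable (A n) :=
    (Finset.measurable_sum _ fun i _ => hQm i).const_mul _
  have hAM (n : ℕ) (x : Y) : |A n x| ≤ M := abs_average_le (fun i => hQM i x) n
  have hA0 (n : ℕ) : ∫ x, A n x ∂μ = 0 := by
    simp only [A]
    rw [integral_const_mul, integral_finsetSum _ fun i _ => hQi i]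
    simp [integral_markovOp_iterate P hμ hf hM, h0]
  obtain ⟨g, hTg, hconv⟩ : ∃ g, T g = g ∧ Tendsto (birkhoffAverage ℝ T _root_.id ·
      ((memLp_of_abs_le hf hM).toLp f)) atTop (𝓝 g) :=
    ⟨_, ((T.eqLocus (1 : Lp ℝ 2 μ →L[ℝ] Lp ℝ 2 μ)).orthogonalProjectionOnto
      ((memLp_of_abs_le hf hM).toLp f)).2,
      T.tendsto_birkhoffAverage_orthogonalProjection hT1 _⟩
  have hconvA : Tendsto (fun n => (memLp_of_abs_le (hAm n) (hAM n)).toLp (A n)) atTop (𝓝 g) := by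
    refine hconv.congr fun n => ?_
    refine Lp.ext ?_
    have hsum : birkhoffAverage ℝ T _root_.id n ((memLp_of_abs_le hf hM).toLp f) =
        (n : ℝ)⁻¹ • ∑ i ∈ Finset.range n,
          (memLp_of_abs_le (hQm i) (hQM i)).toLp ((markovOp P)^[i] f) := by
      simp only [birkhoffAverage, birkhoffSum, id, iterate_toLp_markovOp hT hf hM]
    rw [hsum]
    have hQ : ∀ᵐ x ∂μ, ∀ i, (memLp_of_abs_le (hQm i) (hQM i)).toLp ((markovOp P)^[i] f) x =
        (markovOp P)^[i] f x :=
      ae_all_iff.2 fun i => (memLp_of_abs_le (hQm i) (hQM i)).coeFn_toLp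
    filter_upwards [Lp.coeFn_smul (n : ℝ)⁻¹ (∑ i ∈ Finset.range n,
        (memLp_of_abs_le (hQm i) (hQM i)).toLp ((markovOp P)^[i] f)),
      Lp.coeFn_finsetSum (Finset.range n) (fun i => (memLp_of_abs_le (μ := μ) (hQm i)
        (hQM i)).toLp ((markovOp P)^[i] f)),
      hQ, (memLp_of_abs_le (μ := μ) (hAm n) (hAM n)).coeFn_toLp] with x h1 h2 h3 h4
    rw [h4, h1, Pi.smul_apply, h2]
    simp [A, h3]
  obtain ⟨g', hg', hgM, hgg⟩ := exists_bounded_toLp_eq_of_tendsto hAm hAM hconvA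
  have hg0 : ∫ x, g' x ∂μ = 0 := by
    have hone : MemLp (fun _ : Y => (1 : ℝ)) 2 μ := memLp_const 1
    have hlim := (tendsto_const_nhds (x := hone.toLp _)).inner (𝕜 := ℝ) hconvA
    rw [← hgg] at hlim
    simp only [inner_toLp_eq_integral, one_mul, hA0] at hlim
    exact tendsto_nhds_unique hlim tendsto_const_nhds
  have hfix : ∀ᵐ x ∂μ, ∫ y, g' y ∂(P x) = g' x := by
    have h1 := hT g' M hg' hgM
    rw [hgg, hTg, ← hgg] at h1
    exact ((MemLp.toLp_eq_toLp_iff _ _).1 h1).symm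
  obtain ⟨c, hc⟩ := herg g' hg' ⟨M, hgM⟩ hfix
  have hc0 : c = 0 := by
    rw [integral_congr_ae hc] at hg0
    simpa using hg0
  have hgz : g = 0 := by
    rw [← hgg, Lp.eq_zero_iff_ae_eq_zero]
    refine (MemLp.coeFn_toLp _).trans ?_
    filter_upwards [hc] with x hx
    rw [hx, hc0]
    rfl
  have hlim := (tendsto_const_nhds (x := (memLp_of_abs_le (μ := μ) hf hM).toLp f)).inner
    (𝕜 := ℝ) hconvA
  rw [hgz, inner_zero_right] at hlim
  refine hlim.congr fun n => ?_
  rw [inner_toLp_eq_integral]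
  have hexp (x : Y) : f x * A n x =
      (n : ℝ)⁻¹ * ∑ i ∈ Finset.range n, f x * (markovOp P)^[i] f x := by
    simp only [A]
    rw [← Finset.mul_sum]
    ring
  simp only [hexp]
  rw [integral_const_mul, integral_finsetSum]
  exact fun i _ => (memLp_of_abs_le hf hM).integrable_mul (memLp_of_abs_le (hQm i) (hQM i))

end MeanErgodic

section TrajLaw

variable {Y : Type*} [MeasurableSpace Y] {P : Kernel Y Y} [IsMarkovKernel P] {μ : Measure Y}
  {m : Measure (ℕ → Y)}

lemma IsTrajLaw.map_eq_compProd (hm : IsTrajLaw P μ m) (n : ℕ) :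
    m.map (fun ω => ((fun i : Fin (n + 1) => ω i), ω (n + 1))) =
      (m.map (fun ω => (fun i : Fin (n + 1) => ω i))) ⊗ₘ
        P.comap (fun v : Fin (n + 1) → Y => v (Fin.last n)) (measurable_pi_apply _) := by
  have := hm.1
  rw [hm.2.2 n, Measure.compProd_eq_comp_prod]
  congr 1
  ext1 v
  rw [Kernel.prod_apply, Kernel.id_apply, Kernel.comap_apply, Measure.dirac_prod]

lemma IsTrajLaw.integral_mul_succ (hm : IsTrajLaw P μ m) {g f : Y → ℝ} {K M : ℝ}
    (hg : Measurable g) (hK : ∀ x, |g x| ≤ K) (hf : Measurable f) (hM : ∀ x, |f x| ≤ M)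
    {j n : ℕ} (hjn : j ≤ n) :
    ∫ ω, g (ω j) * f (ω (n + 1)) ∂m = ∫ ω, g (ω j) * markovOp P f (ω n) ∂m := by
  have := hm.1
  let r : (ℕ → Y) → (Fin (n + 1) → Y) := fun ω i => ω i
  have hr : Measurable r := by fun_prop
  have : IsProbabilityMeasure (m.map r) := Measure.isProbabilityMeasure_map hr.aemeasurable
  let j' : Fin (n + 1) := ⟨j, by omega⟩
  let κ := P.comap (fun v : Fin (n + 1) → Y => v (Fin.last n)) (measurable_pi_apply _)
  have hgm : Measurable fun p : (Fin (n + 1) → Y) × Y => g (p.1 j') := by fun_prop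
  have hfm : Measurable fun p : (Fin (n + 1) → Y) × Y => f p.2 := by fun_prop
  have hint : Integrable (fun p : (Fin (n + 1) → Y) × Y => g (p.1 j') * f p.2) (m.map r ⊗ₘ κ) :=
    (memLp_of_abs_le hgm fun p => hK _).integrable_mul (memLp_of_abs_le hfm fun p => hM _)
  have h1 := Measure.integral_compProd hint
  rw [← hm.map_eq_compProd n] at h1
  have hpair : Measurable fun ω : ℕ → Y => ((fun i : Fin (n + 1) => ω i), ω (n + 1)) := by
    fun_prop
  refine (integral_map (f := fun p : (Fin (n + 1) → Y) × Y => g (p.1 j') * f p.2)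
    hpair.aemeasurable (hgm.mul hfm).aestronglyMeasurable).symm.trans (h1.trans ?_)
  simp only [integral_const_mul]
  have hQ : Measurable fun v : Fin (n + 1) → Y => markovOp P f (v (Fin.last n)) :=
    (measurable_markovOp P hf).comp (measurable_pi_apply _)
  exact integral_map (f := fun v : Fin (n + 1) → Y => g (v j') * markovOp P f (v (Fin.last n)))
    hr.aemeasurable ((hg.comp (measurable_pi_apply _)).mul hQ).aestronglyMeasurable

lemma IsTrajLaw.map_eval (hm : IsTrajLaw P μ m) (hμ : μ.bind (fun x => P x) = μ) (n : ℕ) :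
    m.map (fun ω => ω n) = μ := by
  have := hm.1
  induction n with
  | zero => exact hm.2.1
  | succ n ih =>
    have h := congrArg Measure.snd (hm.map_eq_compProd n)
    rw [Measure.snd_compProd, Measure.snd, Measure.map_map (by fun_prop) (by fun_prop),
      ← Kernel.comp_deterministic_eq_comap, ← Measure.comp_assoc,
      Measure.deterministic_comp_eq_map, Measure.map_map (by fun_prop) (by fun_prop)] at h
    refine h.trans ?_
    have he : (fun v : Fin (n + 1) → Y => v (Fin.last n)) ∘ (fun ω : ℕ → Y =>
        fun i : Fin (n + 1) => ω i) = fun ω => ω n := by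
      ext ω
      simp
    rw [he, ih]
    exact hμ

lemma IsTrajLaw.integral_mul_add (hm : IsTrajLaw P μ m) (hμ : μ.bind (fun x => P x) = μ)
    {g f : Y → ℝ} {K M : ℝ} (hg : Measurable g) (hK : ∀ x, |g x| ≤ K) (hf : Measurable f)
    (hM : ∀ x, |f x| ≤ M) (j k : ℕ) :
    ∫ ω, g (ω j) * f (ω (j + k)) ∂m = ∫ x, g x * (markovOp P)^[k] f x ∂μ := by
  induction k generalizing f with
  | zero =>
    have h : AEStronglyMeasurable (fun x => g x * f x) (m.map fun ω => ω j) :=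
      (hg.mul hf).aestronglyMeasurable
    rw [← hm.map_eval hμ j]
    exact (integral_map (φ := fun ω : ℕ → Y => ω j) (measurable_pi_apply j).aemeasurable h).symm
  | succ k ih =>
    rw [← add_assoc, hm.integral_mul_succ hg hK hf hM (Nat.le_add_right j k),
      ih (measurable_markovOp P hf) (abs_markovOp_le P hM), Function.iterate_succ_apply]

/-- The mean ergodic theorem along trajectories of the chain. -/
lemma IsTrajLaw.tendsto_integral_average_sq [IsProbabilityMeasure μ] (hm : IsTrajLaw P μ m)
    (h : IsErgodicInvariant P μ) {f : Y → ℝ} {M : ℝ} (hf : Measurable f) (hM : ∀ x, |f x| ≤ M)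
    (h0 : ∫ x, f x ∂μ = 0) :
    Tendsto (fun n : ℕ => ∫ ω, ((n : ℝ)⁻¹ * ∑ k ∈ Finset.range n, f (ω k)) ^ 2 ∂m) atTop
      (𝓝 0) := by
  have := hm.1
  let a : ℕ → ℝ := fun i => ∫ x, f x * (markovOp P)^[i] f x ∂μ
  let b : ℕ → ℝ := fun n => ∫ ω, (∑ k ∈ Finset.range n, f (ω k)) ^ 2 ∂m
  have ha : Tendsto (fun n : ℕ => (n : ℝ)⁻¹ * ∑ i ∈ Finset.range n, a i) atTop (𝓝 0) :=
    tendsto_average_integral_mul_markovOp h hf hM h0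
  have hL (k : ℕ) : MemLp (fun ω : ℕ → Y => f (ω k)) 2 m :=
    memLp_of_abs_le (by fun_prop) fun ω => hM _
  have hLs (n : ℕ) : MemLp (fun ω : ℕ → Y => ∑ k ∈ Finset.range n, f (ω k)) 2 m :=
    memLp_finsetSum _ fun k _ => hL k
  have hcross (j k : ℕ) : ∫ ω, f (ω j) * f (ω (j + k)) ∂m = a k :=
    hm.integral_mul_add h.1 hf hM hf hM j k
  have hb (n : ℕ) : b (n + 1) = b n + (2 * ∑ i ∈ Finset.range (n + 1), a i - a 0) := by
    have hexp (ω : ℕ → Y) : (∑ k ∈ Finset.range (n + 1), f (ω k)) ^ 2 =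
        (∑ k ∈ Finset.range n, f (ω k)) ^ 2 + 2 * ∑ k ∈ Finset.range n, f (ω k) * f (ω n) +
          f (ω n) * f (ω n) := by
      rw [Finset.sum_range_succ, ← Finset.sum_mul]
      ring
    have hi (k : ℕ) : Integrable (fun ω : ℕ → Y => f (ω k) * f (ω n)) m :=
      (hL k).integrable_mul (hL n)
    have hsum : ∑ k ∈ Finset.range n, ∫ ω, f (ω k) * f (ω n) ∂m =
        ∑ i ∈ Finset.range n, a (i + 1) := by
      rw [← Finset.sum_range_reflect]
      refine Finset.sum_congr rfl fun i hi => ?_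
      rw [Finset.mem_range] at hi
      rw [← hcross (n - 1 - i) (i + 1)]
      have : n - 1 - i + (i + 1) = n := by omega
      rw [this]
    simp only [b, hexp]
    have hi2 : Integrable (fun ω : ℕ → Y => 2 * ∑ k ∈ Finset.range n, f (ω k) * f (ω n)) m :=
      (integrable_finsetSum _ fun k _ => hi k).const_mul 2
    have hi3 : Integrable (fun ω : ℕ → Y => (∑ k ∈ Finset.range n, f (ω k)) ^ 2 +
        2 * ∑ k ∈ Finset.range n, f (ω k) * f (ω n)) m := (hLs n).integrable_sq.add hi2
    rw [integral_add hi3 (hi n), integral_add (hLs n).integrable_sq hi2, integral_const_mul,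
      integral_finsetSum _ fun k _ => hi k, hsum, Finset.sum_range_succ']
    have hsq := hcross n 0
    rw [add_zero] at hsq
    rw [hsq]
    ring
  let e : ℕ → ℝ := fun n => |2 * ∑ i ∈ Finset.range (n + 1), a i - a 0| / ((n + 1 : ℕ) : ℝ)
  have he : Tendsto e atTop (𝓝 0) := by
    have h1 := ((ha.comp (tendsto_add_atTop_nat 1)).const_mul 2).sub
      ((tendsto_inv_atTop_nhds_zero_nat.comp (tendsto_add_atTop_nat 1)).const_mul (a 0))
    rw [mul_zero, mul_zero, sub_zero] at h1
    have h2 := h1.abs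
    rw [abs_zero] at h2
    refine h2.congr fun n => ?_
    have hn : (0 : ℝ) < ((n + 1 : ℕ) : ℝ) := by positivity
    simp only [Function.comp_apply, e]
    rw [← abs_of_pos hn, ← abs_div, abs_of_pos hn]
    congr 1
    field_simp
  have hbe (n : ℕ) : b n ≤ n * ∑ k ∈ Finset.range n, e k := by
    induction n with
    | zero => simp [b]
    | succ n ih =>
      have he0 : 0 ≤ ∑ k ∈ Finset.range n, e k :=
        Finset.sum_nonneg fun k _ => div_nonneg (abs_nonneg _) (Nat.cast_nonneg _)
      have hn : ((n + 1 : ℕ) : ℝ) ≠ 0 := by positivity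
      have hen : ((n + 1 : ℕ) : ℝ) * e n = |2 * ∑ i ∈ Finset.range (n + 1), a i - a 0| :=
        mul_div_cancel₀ _ hn
      rw [hb, Finset.sum_range_succ e, mul_add, hen]
      have := le_abs_self (2 * ∑ i ∈ Finset.range (n + 1), a i - a 0)
      push_cast
      linarith
  refine squeeze_zero (fun n => integral_nonneg fun ω => sq_nonneg _) (fun n => ?_) he.cesaro
  simp only [mul_pow]
  rw [integral_const_mul]
  change ((n : ℝ)⁻¹) ^ 2 * b n ≤ _
  rcases Nat.eq_zero_or_pos n with rfl | hn
  · simp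
  · have hn' : (0 : ℝ) < n := by exact_mod_cast hn
    calc ((n : ℝ)⁻¹) ^ 2 * b n ≤ ((n : ℝ)⁻¹) ^ 2 * (n * ∑ k ∈ Finset.range n, e k) := by
          gcongr
          exact hbe n
      _ = (n : ℝ)⁻¹ * ∑ k ∈ Finset.range n, e k := by
          field_simp

/-- Every subsequence of the time averages of a bounded observable has a further subsequence
converging almost surely to the space average. -/
lemma IsTrajLaw.exists_subseq_tendsto_average [IsProbabilityMeasure μ] (hm : IsTrajLaw P μ m)
    (h : IsErgodicInvariant P μ) {f : Y → ℝ} {M : ℝ} (hf : Measurable f) (hM : ∀ x, |f x| ≤ M)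
    {u : ℕ → ℕ} (hu : StrictMono u) :
    ∃ v : ℕ → ℕ, StrictMono v ∧ ∀ᵐ ω ∂m, Tendsto (fun i => ((u (v i) : ℕ) : ℝ)⁻¹ *
      ∑ k ∈ Finset.range (u (v i)), f (ω k)) atTop (𝓝 (∫ x, f x ∂μ)) := by
  have := hm.1
  obtain ⟨c, hc⟩ : ∃ c, c = ∫ x, f x ∂μ := ⟨_, rfl⟩
  rw [← hc]
  have hfi : Integrable f μ := (memLp_of_abs_le hf hM).integrable one_le_two
  have h0 : ∫ x, (f x - c) ∂μ = 0 := by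
    rw [integral_sub hfi (integrable_const c)]
    simp [hc]
  have hM' (x : Y) : |f x - c| ≤ M + |c| := (abs_sub _ _).trans (by linarith [hM x])
  let S : ℕ → (ℕ → Y) → ℝ := fun n ω => (n : ℝ)⁻¹ * ∑ k ∈ Finset.range n, (f (ω k) - c)
  have hfk (k : ℕ) : Measurable fun ω : ℕ → Y => f (ω k) - c :=
    (hf.comp (measurable_pi_apply k)).sub_const c
  have hSm (n : ℕ) : Measurable (S n) := (Finset.measurable_sum _ fun k _ => hfk k).const_mul _
  have hSM (n : ℕ) (ω : ℕ → Y) : |S n ω| ≤ M + |c| := abs_average_le (fun k => hM' (ω k)) n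
  have hlim : Tendsto (fun n => ∫ ω, S n ω ^ 2 ∂m) atTop (𝓝 0) :=
    hm.tendsto_integral_average_sq (f := fun x => f x - c) h (hf.sub_const c) hM' h0
  have hnorm : Tendsto (fun n => eLpNorm ((fun ω => S (u n) ω ^ 2) - 0) 1 m) atTop (𝓝 0) := by
    have := (ENNReal.tendsto_ofReal hlim).comp hu.tendsto_atTop
    rw [ENNReal.ofReal_zero] at this
    refine this.congr fun n => ?_
    rw [sub_zero, eLpNorm_one_eq_lintegral_enorm, ← ofReal_integral_norm_eq_lintegral_enorm
      (memLp_of_abs_le (hSm _) (hSM _)).integrable_sq]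
    simp
  obtain ⟨v, hv, hae⟩ := (tendstoInMeasure_of_tendsto_eLpNorm one_ne_zero
    (fun n => ((hSm _).pow_const 2).aestronglyMeasurable) aestronglyMeasurable_zero
    hnorm).exists_seq_tendsto_ae
  refine ⟨v, hv, ?_⟩
  filter_upwards [hae] with ω hω
  have hω' : Tendsto (fun i => S (u (v i)) ω) atTop (𝓝 0) := by
    have := hω.sqrt
    simp only [Real.sqrt_sq_eq_abs, Pi.zero_apply, Real.sqrt_zero] at this
    exact tendsto_zero_iff_abs_tendsto_zero _ |>.2 this
  have h2 := hω'.add_const c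
  rw [zero_add] at h2
  refine h2.congr' ?_
  filter_upwards [(hu.comp hv).tendsto_atTop.eventually_gt_atTop 0] with i hi
  have : ((u (v i) : ℕ) : ℝ) ≠ 0 := by exact_mod_cast hi.ne'
  simp only [S, Finset.sum_sub_distrib, Finset.sum_const, Finset.card_range, nsmul_eq_mul]
  field_simp
  ring

lemma IsTrajLaw.unique {m' : Measure (ℕ → Y)} (hm : IsTrajLaw P μ m) (hm' : IsTrajLaw P μ m') :
    m = m' := by
  have := hm.1
  have := hm'.1
  have hfin (n : ℕ) : m.map (fun ω => (fun i : Fin (n + 1) => ω i)) =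
      m'.map (fun ω => (fun i : Fin (n + 1) => ω i)) := by
    induction n with
    | zero =>
      have h := hm.2.1.trans hm'.2.1.symm
      have h2 := congrArg (Measure.map fun (y : Y) (_ : Fin (0 + 1)) => y) h
      rw [Measure.map_map (by fun_prop) (by fun_prop),
        Measure.map_map (by fun_prop) (by fun_prop)] at h2
      have he : (fun (y : Y) (_ : Fin (0 + 1)) => y) ∘ (fun ω : ℕ → Y => ω 0) =
          fun ω (i : Fin (0 + 1)) => ω i := by
        ext ω i
        fin_cases i
        rfl
      rwa [he] at h2
    | succ n ih =>
      have h := hm.map_eq_compProd n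
      rw [ih, ← hm'.map_eq_compProd n] at h
      let s : (Fin (n + 1) → Y) × Y → (Fin (n + 1 + 1) → Y) := fun p =>
        Fin.snoc (α := fun _ => Y) p.1 p.2
      have hs : Measurable s := by
        refine measurable_pi_iff.2 fun i => ?_
        refine Fin.lastCases ?_ (fun i => ?_) i
        · simpa [s] using measurable_snd
        · simpa [s] using! (measurable_pi_apply i).comp measurable_fst
      have h2 := congrArg (Measure.map s) h
      rw [Measure.map_map hs (by fun_prop), Measure.map_map hs (by fun_prop)] at h2
      have he : s ∘ (fun ω : ℕ → Y => ((fun i : Fin (n + 1) => ω i), ω (n + 1))) =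
          fun ω (i : Fin (n + 1 + 1)) => ω i := by
        ext ω i
        refine Fin.lastCases ?_ (fun i => ?_) i <;> simp [s]
      rwa [he] at h2
  have hproj : IsProjectiveLimit m fun I : Finset ℕ => m'.map I.restrict := by
    intro I
    let r : (Fin (I.sup id + 1) → Y) → (I → Y) := fun v i =>
      v ⟨i, Nat.lt_succ_of_le (Finset.le_sup (f := id) i.2)⟩
    have hr : Measurable r := by fun_prop
    have h := congrArg (Measure.map r) (hfin (I.sup id))
    rwa [Measure.map_map hr (by fun_prop), Measure.map_map hr (by fun_prop)] at h
  have (I : Finset ℕ) : IsFiniteMeasure (m'.map (I.restrict (π := fun _ => Y))) :=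
    inferInstance
  exact hproj.unique fun I => rfl

end TrajLaw

section AsymptoticCoupling

lemma tendsto_average_sub_of_mem_diagInf {X : Type*} [PseudoMetricSpace X] {f : X → ℝ} {L : ℝ≥0}
    (hf : LipschitzWith L f)
    {p : (ℕ → X) × (ℕ → X)} (hp : p ∈ diagInf X) :
    Tendsto (fun n : ℕ => (n : ℝ)⁻¹ * ∑ k ∈ Finset.range n, f (p.1 k) -
      (n : ℝ)⁻¹ * ∑ k ∈ Finset.range n, f (p.2 k)) atTop (𝓝 0) := by
  have h1 : Tendsto (fun n => f (p.1 n) - f (p.2 n)) atTop (𝓝 0) := by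
    have hp' : Tendsto (fun n => L * dist (p.1 n) (p.2 n)) atTop (𝓝 0) := by
      simpa using Tendsto.const_mul (L : ℝ) hp
    exact squeeze_zero_norm (fun n => by
      rw [← dist_eq_norm]
      exact hf.dist_le_mul _ _) hp'
  refine h1.cesaro.congr fun n => ?_
  rw [Finset.sum_sub_distrib, mul_sub]

variable {X : Type*} [MetricSpace X] [MeasurableSpace X] [BorelSpace X]

lemma measurableSet_diagInf [SecondCountableTopology X] : MeasurableSet (diagInf X) := by
  refine measurableSet_tendsto _ fun n => ?_
  exact ((measurable_pi_apply n).comp measurable_fst).dist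
    ((measurable_pi_apply n).comp measurable_snd)

lemma ext_of_forall_lipschitz_integral_eq {μ ν : Measure X} [IsProbabilityMeasure μ]
    [IsProbabilityMeasure ν]
    (h : ∀ f : X → ℝ, (∃ M, ∀ x, |f x| ≤ M) → (∃ L, LipschitzWith L f) →
      ∫ x, f x ∂μ = ∫ x, f x ∂ν) : μ = ν := by
  have hX : Nonempty X := μ.nonempty_of_neZero
  let μ' : ProbabilityMeasure X := ⟨μ, inferInstance⟩
  let ν' : ProbabilityMeasure X := ⟨ν, inferInstance⟩
  have hlim : Tendsto (fun _ : ℕ => μ') atTop (𝓝 ν') := by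
    rw [tendsto_iff_forall_lipschitz_integral_tendsto]
    rintro f ⟨C, hC⟩ hL
    have hb : ∃ M, ∀ x, |f x| ≤ M := by
      refine ⟨C + |f hX.some|, fun x => ?_⟩
      have := hC x hX.some
      rw [Real.dist_eq] at this
      have := abs_sub_abs_le_abs_sub (f x) (f hX.some)
      linarith
    have hfμ : ∫ x, f x ∂(μ' : Measure X) = ∫ x, f x ∂(ν' : Measure X) := h f hb hL
    rw [hfμ]
    exact tendsto_const_nhds
  have hμν : μ' = ν' := tendsto_nhds_unique tendsto_const_nhds hlim
  exact congrArg Subtype.val hμν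

/-- Ergodic invariant measures whose trajectory laws admit a generalised coupling charging the
diagonal at infinity coincide. -/
lemma eq_of_generalized_asymptotic_coupling {P : Kernel X X} [IsMarkovKernel P]
    {μ₁ μ₂ : Measure X} [IsProbabilityMeasure μ₁] [IsProbabilityMeasure μ₂]
    (h₁ : IsErgodicInvariant P μ₁) (h₂ : IsErgodicInvariant P μ₂) {m₁ m₂ : Measure (ℕ → X)}
    (hm₁ : IsTrajLaw P μ₁ m₁) (hm₂ : IsTrajLaw P μ₂ m₂) {Γ : Measure ((ℕ → X) × (ℕ → X))}
    (hΓ₁ : Γ.map Prod.fst ≪ m₁) (hΓ₂ : Γ.map Prod.snd ≪ m₂) (hD : 0 < Γ (diagInf X)) :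
    μ₁ = μ₂ := by
  refine ext_of_forall_lipschitz_integral_eq ?_
  rintro f ⟨M, hM⟩ ⟨L, hL⟩
  have hf : Measurable f := hL.continuous.measurable
  obtain ⟨u, hu, hu1⟩ := hm₁.exists_subseq_tendsto_average h₁ hf hM strictMono_id
  obtain ⟨v, hv, hv2⟩ := hm₂.exists_subseq_tendsto_average h₂ hf hM hu
  have hae1 := ae_of_ae_map measurable_fst.aemeasurable (hΓ₁.ae_le hu1)
  have hae2 := ae_of_ae_map measurable_snd.aemeasurable (hΓ₂.ae_le hv2)
  have hfreq : ∃ᵐ p ∂Γ, p ∈ diagInf X := frequently_ae_mem_iff.2 hD.ne'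
  obtain ⟨p, hp, hp1, hp2⟩ := (hfreq.and_eventually (hae1.and hae2)).exists
  have hdiff := (tendsto_average_sub_of_mem_diagInf hL hp).comp (hu.comp hv).tendsto_atTop
  have hlim := (hp1.comp hv.tendsto_atTop).sub hp2
  exact sub_eq_zero.1 (tendsto_nhds_unique hlim hdiff)

lemma exists_coupling_diagInf_self [SecondCountableTopology X] (m : Measure (ℕ → X))
    [IsProbabilityMeasure m] :
    ∃ Γ : Measure ((ℕ → X) × (ℕ → X)), IsCoupling Γ m m ∧ Γ (diagInf X) = 1 := by
  have hd : Measurable fun ω : ℕ → X => (ω, ω) := by fun_prop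
  refine ⟨m.map fun ω => (ω, ω), ⟨?_, ?_⟩, ?_⟩
  · rw [Measure.map_map measurable_fst hd]
    exact Measure.map_id
  · rw [Measure.map_map measurable_snd hd]
    exact Measure.map_id
  · rw [Measure.map_apply hd measurableSet_diagInf]
    have : (fun ω : ℕ → X => (ω, ω)) ⁻¹' diagInf X = Set.univ := by
      ext ω
      simp [diagInf]
    rw [this, measure_univ]

end AsymptoticCoupling

/-- **Theorem 1.1 (Hairer–Mattingly–Scheutzow)**: for two ergodic invariant measures of a
Markov kernel on a Polish space, equality is equivalent to the existence of an asymptotic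
coupling of the trajectory laws, and also to the existence of a "generalised coupling"
(with absolutely continuous marginals) giving positive mass to the diagonal at infinity. -/
theorem stmt_0 {X : Type*} [MetricSpace X] [CompleteSpace X] [SecondCountableTopology X]
    [MeasurableSpace X] [BorelSpace X]
    (P : Kernel X X) [IsMarkovKernel P]
    (μ₁ μ₂ : Measure X) [IsProbabilityMeasure μ₁] [IsProbabilityMeasure μ₂]
    (h₁ : IsErgodicInvariant P μ₁) (h₂ : IsErgodicInvariant P μ₂)
    (m₁ m₂ : Measure (ℕ → X)) (hm₁ : IsTrajLaw P μ₁ m₁) (hm₂ : IsTrajLaw P μ₂ m₂) :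
    (μ₁ = μ₂ ↔
      ∃ Γ : Measure ((ℕ → X) × (ℕ → X)), IsCoupling Γ m₁ m₂ ∧ Γ (diagInf X) = 1) ∧
    (μ₁ = μ₂ ↔
      ∃ Γ : Measure ((ℕ → X) × (ℕ → X)), IsProbabilityMeasure Γ ∧
        Γ.map Prod.fst ≪ m₁ ∧ Γ.map Prod.snd ≪ m₂ ∧ 0 < Γ (diagInf X)) := by
  have := hm₁.1
  have h12 : μ₁ = μ₂ → ∃ Γ : Measure ((ℕ → X) × (ℕ → X)),
      IsCoupling Γ m₁ m₂ ∧ Γ (diagInf X) = 1 := by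
    rintro rfl
    rw [← hm₁.unique hm₂]
    exact exists_coupling_diagInf_self m₁
  have h23 : (∃ Γ : Measure ((ℕ → X) × (ℕ → X)), IsCoupling Γ m₁ m₂ ∧ Γ (diagInf X) = 1) →
      ∃ Γ : Measure ((ℕ → X) × (ℕ → X)), IsProbabilityMeasure Γ ∧
        Γ.map Prod.fst ≪ m₁ ∧ Γ.map Prod.snd ≪ m₂ ∧ 0 < Γ (diagInf X) := by
    rintro ⟨Γ, ⟨hΓ₁, hΓ₂⟩, hD⟩
    have hprob : IsProbabilityMeasure (Γ.map Prod.fst) := hΓ₁ ▸ hm₁.1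
    refine ⟨Γ, (Measure.isProbabilityMeasure_map_iff measurable_fst.aemeasurable).1 hprob,
      hΓ₁.absolutelyContinuous, hΓ₂.absolutelyContinuous, ?_⟩
    rw [hD]
    exact one_pos
  have h31 : (∃ Γ : Measure ((ℕ → X) × (ℕ → X)), IsProbabilityMeasure Γ ∧
      Γ.map Prod.fst ≪ m₁ ∧ Γ.map Prod.snd ≪ m₂ ∧ 0 < Γ (diagInf X)) → μ₁ = μ₂ := by
    rintro ⟨Γ, -, hΓ₁, hΓ₂, hD⟩
    exact eq_of_generalized_asymptotic_coupling h₁ h₂ hm₁ hm₂ hΓ₁ hΓ₂ hD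
  exact ⟨⟨h12, h31 ∘ h23⟩, ⟨h23 ∘ h12, h31⟩⟩
end
end

section
/- Let P be a Markov transition kernel on a Polish space X with metric d. Suppose there exists a measurable set A ⊆ X with the following two properties: (i) μ(A) > 0 for every invariant probability measure μ of P; (ii) there exists a measurable map A × A ∋ (x,y) ↦ Γ_{x,y} ∈ C̃(P_[∞]δ_x, P_[∞]δ_y) such that Γ_{x,y}(D) > 0 for every x, y ∈ A. Then P has at most one invariant probability measure. -/
open MeasureTheory ProbabilityTheory Filter Topology BoundedContinuousFunction
open scoped ENNReal NNReal

noncomputable section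

namespace MarkovAverage

variable {X : Type*} [MeasurableSpace X]

/-- Bounded measurable real functions. -/
def BddMeas (f : X → ℝ) : Prop := Measurable f ∧ ∃ C, ∀ x, |f x| ≤ C

/-- The function `x ↦ ∫ f dP(x, ·)`. -/
def mean (P : Kernel X X) (f : X → ℝ) (x : X) : ℝ := ∫ y, f y ∂(P x)

/-- The expectation of `φ(X₀) + ⋯ + φ(Xₙ₋₁)` for the chain started at `x`. -/
def sumMean (P : Kernel X X) (φ : X → ℝ) : ℕ → X → ℝ
  | 0 => 0
  | n + 1 => fun x => φ x + mean P (sumMean P φ n) x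

/-- The expectation of `(φ(X₀) + ⋯ + φ(Xₙ₋₁))²` for the chain started at `x`. -/
def sumSq (P : Kernel X X) (φ : X → ℝ) : ℕ → X → ℝ
  | 0 => 0
  | n + 1 => fun x => φ x ^ 2 + 2 * φ x * mean P (sumMean P φ n) x + mean P (sumSq P φ n) x

/-- The expectation of `(s + φ(X₀) + ⋯ + φ(Xₙ₋₁))²` for the chain started at `x`, as a function
of `(x, s)`. -/
def shiftedSq (P : Kernel X X) (φ : X → ℝ) : ℕ → X × ℝ → ℝ≥0∞
  | 0 => fun p => ENNReal.ofReal (p.2 ^ 2)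
  | n + 1 => fun p => ∫⁻ y, shiftedSq P φ n (y, p.2 + φ p.1) ∂(P p.1)

namespace BddMeas

variable {f h : X → ℝ}

lemma add (hf : BddMeas f) (hh : BddMeas h) : BddMeas (fun x => f x + h x) := by
  obtain ⟨hf, C, hC⟩ := hf
  obtain ⟨hh, D, hD⟩ := hh
  exact ⟨hf.add hh, C + D, fun x => (abs_add_le _ _).trans (add_le_add (hC x) (hD x))⟩

lemma mul (hf : BddMeas f) (hh : BddMeas h) : BddMeas (fun x => f x * h x) := by
  obtain ⟨hf, C, hC⟩ := hf
  obtain ⟨hh, D, hD⟩ := hh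
  refine ⟨hf.mul hh, C * D, fun x => ?_⟩
  rw [abs_mul]
  exact mul_le_mul (hC x) (hD x) (abs_nonneg _) ((abs_nonneg _).trans (hC x))

lemma const (c : ℝ) : BddMeas (fun _ : X => c) := ⟨measurable_const, |c|, fun _ => le_rfl⟩

lemma memLp (hf : BddMeas f) (μ : Measure X) [IsFiniteMeasure μ] (p : ℝ≥0∞) : MemLp f p μ := by
  obtain ⟨hf, C, hC⟩ := hf
  exact MemLp.of_bound hf.aestronglyMeasurable C (ae_of_all _ hC)

lemma integrable (hf : BddMeas f) (μ : Measure X) [IsFiniteMeasure μ] : Integrable f μ :=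
  memLp_one_iff_integrable.1 (hf.memLp μ 1)

lemma mean (hf : BddMeas f) (P : Kernel X X) [IsMarkovKernel P] : BddMeas (mean P f) := by
  obtain ⟨hf, C, hC⟩ := hf
  refine ⟨hf.stronglyMeasurable.integral_kernel.measurable, C, fun x => ?_⟩
  simpa [MarkovAverage.mean] using
    norm_integral_le_of_norm_le_const (μ := P x) (f := f) (ae_of_all _ hC)

end BddMeas

variable {P : Kernel X X} {φ : X → ℝ}

lemma bddMeas_sumMean [IsMarkovKernel P] (hφ : BddMeas φ) (n : ℕ) :
    BddMeas (sumMean P φ n) := by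
  induction n with
  | zero => exact BddMeas.const 0
  | succ n ih => exact hφ.add (ih.mean P)

lemma bddMeas_sumSq [IsMarkovKernel P] (hφ : BddMeas φ) (n : ℕ) :
    BddMeas (sumSq P φ n) := by
  induction n with
  | zero => exact BddMeas.const 0
  | succ n ih =>
    have := ((hφ.mul hφ).add (((BddMeas.const 2).mul hφ).mul
      ((bddMeas_sumMean (P := P) hφ n).mean P))).add (ih.mean P)
    simp only [← pow_two] at this
    exact this

lemma measurable_shiftedSq [IsMarkovKernel P] (hφ : Measurable φ) (n : ℕ) :
    Measurable (shiftedSq P φ n) := by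
  induction n with
  | zero =>
    show Measurable (fun p : X × ℝ => ENNReal.ofReal (p.2 ^ 2))
    fun_prop
  | succ n ih =>
    have h : Measurable (fun q : (X × ℝ) × X => shiftedSq P φ n (q.2, q.1.2 + φ q.1.1)) := by
      fun_prop
    exact Measurable.lintegral_kernel_prod_right' (κ := P.comap Prod.fst measurable_fst) h

/-- Expansion of `shiftedSq` as a quadratic polynomial in the shift. -/
lemma shiftedSq_eq [IsMarkovKernel P] (hφ : BddMeas φ) (n : ℕ) (x : X) (s : ℝ) :
    0 ≤ s ^ 2 + 2 * s * sumMean P φ n x + sumSq P φ n x ∧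
    shiftedSq P φ n (x, s)
      = ENNReal.ofReal (s ^ 2 + 2 * s * sumMean P φ n x + sumSq P φ n x) := by
  induction n generalizing x s with
  | zero => simp [shiftedSq, sumMean, sumSq, sq_nonneg]
  | succ n ih =>
    have hm := (bddMeas_sumMean (P := P) hφ n).integrable (P x)
    have hs := (bddMeas_sumSq (P := P) hφ n).integrable (P x)
    have hi : Integrable (fun y => (s + φ x) ^ 2 + 2 * (s + φ x) * sumMean P φ n y) (P x) :=
      (integrable_const _).add (hm.const_mul _)
    have hnn := ae_of_all (P x) fun y => (ih y (s + φ x)).1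
    have key : s ^ 2 + 2 * s * sumMean P φ (n + 1) x + sumSq P φ (n + 1) x
        = ∫ y, ((s + φ x) ^ 2 + 2 * (s + φ x) * sumMean P φ n y + sumSq P φ n y) ∂(P x) := by
      rw [integral_add hi hs, integral_add (integrable_const _) (hm.const_mul _),
        integral_const_mul]
      simp only [sumMean, sumSq, mean, integral_const, probReal_univ, one_smul]
      ring
    rw [key]
    refine ⟨integral_nonneg fun y => (ih y _).1, ?_⟩
    rw [ofReal_integral_eq_lintegral_ofReal (by exact hi.add hs) hnn]
    exact lintegral_congr fun y => (ih y _).2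

lemma _root_.IsTrajLaw.lintegral_succ [IsMarkovKernel P] {μ : Measure X} {m : Measure (ℕ → X)}
    (hm : IsTrajLaw P μ m) (n : ℕ) {G : (Fin (n + 1) → X) × X → ℝ≥0∞} (hG : Measurable G) :
    ∫⁻ ω, G (fun i => ω i, ω (n + 1)) ∂m
      = ∫⁻ ω, ∫⁻ y, G (fun i => ω i, y) ∂(P (ω n)) ∂m := by
  have hP : Measurable (fun v : Fin (n + 1) → X =>
      (P (v (Fin.last n))).map (fun y => (v, y))) := by
    refine Measure.measurable_of_measurable_coe _ fun s hs => ?_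
    have : ∀ v : Fin (n + 1) → X, ((P (v (Fin.last n))).map (fun y => (v, y))) s
        = P (v (Fin.last n)) (Prod.mk v ⁻¹' s) := fun v =>
      Measure.map_apply measurable_prodMk_left hs
    simp_rw [this]
    exact Kernel.measurable_kernel_prodMk_left
      (κ := P.comap (fun v : Fin (n + 1) → X => v (Fin.last n)) (by fun_prop)) hs
  have hG' : Measurable (fun v : Fin (n + 1) → X =>
      ∫⁻ q, G q ∂((P (v (Fin.last n))).map (fun y => (v, y)))) :=
    (Measure.measurable_lintegral hG).comp hP
  have h := congrArg (fun ν => ∫⁻ q, G q ∂ν) (hm.2.2 n)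
  rw [lintegral_map hG (by fun_prop), Measure.lintegral_bind hP.aemeasurable hG.aemeasurable,
    lintegral_map hG' (by fun_prop)] at h
  rw [h]
  refine lintegral_congr fun ω => ?_
  rw [lintegral_map hG measurable_prodMk_left]
  simp

lemma _root_.IsTrajLaw.lintegral_sq [IsMarkovKernel P] {x : X} {m : Measure (ℕ → X)}
    (hm : IsTrajLaw P (Measure.dirac x) m) (hφ : Measurable φ) (n : ℕ) (s : ℝ) :
    ∫⁻ ω, ENNReal.ofReal ((s + ∑ i ∈ Finset.range n, φ (ω i)) ^ 2) ∂m
      = shiftedSq P φ n (x, s) := by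
  have step : ∀ n N, ∫⁻ ω, shiftedSq P φ N (ω n, s + ∑ i ∈ Finset.range n, φ (ω i)) ∂m
      = ∫⁻ ω, shiftedSq P φ (n + N) (ω 0, s) ∂m := by
    intro n
    induction n with
    | zero => simp
    | succ n ih =>
      intro N
      rw [show n + 1 + N = n + (N + 1) by ring, ← ih (N + 1)]
      have hV := measurable_shiftedSq (P := P) hφ N
      have h := hm.lintegral_succ n
        (G := fun q => shiftedSq P φ N (q.2, s + ∑ i, φ (q.1 i))) (by fun_prop)
      have hsum : ∀ ω : ℕ → X, ∑ i : Fin (n + 1), φ (ω i) = ∑ i ∈ Finset.range (n + 1), φ (ω i) :=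
        fun ω => Fin.sum_univ_eq_sum_range (fun i => φ (ω i)) (n + 1)
      simp only [hsum] at h
      rw [h]
      refine lintegral_congr fun ω => ?_
      simp only [shiftedSq, Finset.sum_range_succ, add_assoc]
  have h0 := step n 0
  have hV : Measurable (fun y => shiftedSq P φ n (y, s)) :=
    (measurable_shiftedSq hφ n).comp (by fun_prop)
  simp only [shiftedSq, add_zero] at h0
  rw [h0, ← lintegral_map (g := fun ω : ℕ → X => ω 0) hV (by fun_prop), hm.2.1,
    lintegral_dirac' _ hV]

section Invariant

variable {μ : Measure X} [IsFiniteMeasure μ] [IsMarkovKernel P]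

lemma measurePreserving_fst_compProd : MeasurePreserving Prod.fst (μ ⊗ₘ P) μ :=
  ⟨measurable_fst, Measure.fst_compProd μ P⟩

lemma measurePreserving_snd_compProd (hμ : μ.bind P = μ) :
    MeasurePreserving Prod.snd (μ ⊗ₘ P) μ :=
  ⟨measurable_snd, (Measure.snd_compProd μ P).trans hμ⟩

lemma integral_mean {f : X → ℝ} (hf : BddMeas f) (hμ : μ.bind P = μ) :
    ∫ x, mean P f x ∂μ = ∫ x, f x ∂μ := by
  have hsnd := measurePreserving_snd_compProd hμ
  have h : Integrable (fun p : X × X => f p.2) (μ ⊗ₘ P) :=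
    hsnd.integrable_comp_of_integrable (hf.integrable μ)
  rw [← hsnd.map_eq, integral_map measurable_snd.aemeasurable hf.1.aestronglyMeasurable,
    Measure.integral_compProd h, hsnd.map_eq]
  rfl

lemma exists_adjoint_comp {E F : Type*} [NormedAddCommGroup E] [InnerProductSpace ℝ E]
    [CompleteSpace E] [NormedAddCommGroup F] [InnerProductSpace ℝ F] [CompleteSpace F]
    (U V : E →ₗᵢ[ℝ] F) :
    ∃ T : E →L[ℝ] E, ‖T‖ ≤ 1 ∧ ∀ h f, inner ℝ h (T f) = inner ℝ (U h) (V f) := by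
  let A : F →L[ℝ] E := ContinuousLinearMap.adjoint U.toContinuousLinearMap
  have hA : ‖A‖ ≤ 1 :=
    (LinearIsometryEquiv.norm_map _ _).trans_le U.norm_toContinuousLinearMap_le
  refine ⟨A.comp V.toContinuousLinearMap, ?_, fun h f => ?_⟩
  · exact (A.opNorm_comp_le _).trans
      (mul_le_one₀ hA (norm_nonneg _) V.norm_toContinuousLinearMap_le)
  · exact ContinuousLinearMap.adjoint_inner_right U.toContinuousLinearMap h (V f)

/-- A kernel with invariant measure `μ` acts on `L²(μ)` as a contraction whose fixed points are
almost surely constant along transitions. -/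
lemma exists_L2_operator (hμ : μ.bind P = μ) :
    ∃ T : Lp ℝ 2 μ →L[ℝ] Lp ℝ 2 μ, ‖T‖ ≤ 1 ∧
      (∀ f (hf : BddMeas f), T ((hf.memLp μ 2).toLp f)
        = ((hf.mean P).memLp μ 2).toLp (mean P f)) ∧
      ∀ g, T g = g → ∀ᵐ p ∂(μ ⊗ₘ P), g p.1 = g p.2 := by
  have hfst : MeasurePreserving Prod.fst (μ ⊗ₘ P) μ := measurePreserving_fst_compProd
  have hsnd := measurePreserving_snd_compProd hμ
  obtain ⟨U, hU⟩ : ∃ U : Lp ℝ 2 μ →ₗᵢ[ℝ] Lp ℝ 2 (μ ⊗ₘ P),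
      ∀ g, U g =ᵐ[μ ⊗ₘ P] fun p => g p.1 :=
    ⟨Lp.compMeasurePreservingₗᵢ ℝ Prod.fst hfst, fun g => Lp.coeFn_compMeasurePreserving g hfst⟩
  obtain ⟨V, hV⟩ : ∃ V : Lp ℝ 2 μ →ₗᵢ[ℝ] Lp ℝ 2 (μ ⊗ₘ P),
      ∀ g, V g =ᵐ[μ ⊗ₘ P] fun p => g p.2 :=
    ⟨Lp.compMeasurePreservingₗᵢ ℝ Prod.snd hsnd, fun g => Lp.coeFn_compMeasurePreserving g hsnd⟩
  obtain ⟨T, hTnorm, hT⟩ := exists_adjoint_comp U V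
  refine ⟨T, hTnorm, fun f hf => ?_, fun g hg => ?_⟩
  · refine ext_inner_left ℝ fun h => ?_
    rw [hT, L2.inner_def, L2.inner_def]
    have hVf : V ((hf.memLp μ 2).toLp f) =ᵐ[μ ⊗ₘ P] fun p => f p.2 :=
      (hV _).trans (hsnd.quasiMeasurePreserving.ae_eq_comp (hf.memLp μ 2).coeFn_toLp)
    have h1 : (fun p => inner ℝ (U h p) (V ((hf.memLp μ 2).toLp f) p))
        =ᵐ[μ ⊗ₘ P] fun p => f p.2 * h p.1 := by
      filter_upwards [hU h, hVf] with p hp hp'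
      rw [hp, hp']
      rfl
    have hint : Integrable (fun p : X × X => f p.2 * h p.1) (μ ⊗ₘ P) :=
      (L2.integrable_inner (𝕜 := ℝ) (U h) (V ((hf.memLp μ 2).toLp f))).congr h1
    rw [integral_congr_ae h1, Measure.integral_compProd hint]
    refine integral_congr_ae ?_
    filter_upwards [((hf.mean P).memLp μ 2).coeFn_toLp] with x hx
    rw [hx, integral_mul_const]
    rfl
  · have h : U g = V g := by
      rw [← sub_eq_zero, ← norm_eq_zero, ← sq_eq_zero_iff, norm_sub_sq_real, ← hT, hg,
        U.norm_map, V.norm_map, real_inner_self_eq_norm_sq]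
      ring
    filter_upwards [hU g, hV g] with p hp hp'
    rw [← hp, ← hp', h]

end Invariant

lemma tendsto_weighted_average {u : ℕ → ℝ} {a : ℝ} (hu : Tendsto u atTop (𝓝 a)) :
    Tendsto (fun n : ℕ => ((n : ℝ) ^ 2)⁻¹ * ∑ k ∈ Finset.range n, ((k : ℝ) + 1) * u (k + 1))
      atTop (𝓝 (a / 2)) := by
  have hsum : ∀ n : ℕ, ∑ k ∈ Finset.range n, ((k : ℝ) + 1) = n * (n + 1) / 2 := by
    intro n
    induction n with
    | zero => simp
    | succ n ih => rw [Finset.sum_range_succ, ih]; push_cast; ring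
  have hu' : Tendsto (fun k => |u (k + 1) - a|) atTop (𝓝 0) := by
    simpa using (((tendsto_add_atTop_iff_nat 1).2 hu).sub_const a).abs
  have herr : Tendsto (fun n : ℕ => ((n : ℝ) ^ 2)⁻¹ *
      ∑ k ∈ Finset.range n, ((k : ℝ) + 1) * (u (k + 1) - a)) atTop (𝓝 0) := by
    refine squeeze_zero_norm (fun n => ?_) hu'.cesaro
    rcases n.eq_zero_or_pos with rfl | hn
    · simp
    have hn' : (0 : ℝ) < n := by exact_mod_cast hn
    rw [norm_mul, norm_inv, norm_pow, Real.norm_natCast]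
    calc ((n : ℝ) ^ 2)⁻¹ * ‖∑ k ∈ Finset.range n, ((k : ℝ) + 1) * (u (k + 1) - a)‖
        ≤ ((n : ℝ) ^ 2)⁻¹ * ∑ k ∈ Finset.range n, n * |u (k + 1) - a| := by
          gcongr
          refine norm_sum_le_of_le _ fun k hk => ?_
          have hk' : (k : ℝ) + 1 ≤ n := by exact_mod_cast Finset.mem_range.1 hk
          rw [norm_mul, Real.norm_of_nonneg (by positivity), Real.norm_eq_abs]
          gcongr
      _ = (n : ℝ)⁻¹ * ∑ k ∈ Finset.range n, |u (k + 1) - a| := by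
          rw [← Finset.mul_sum]
          field_simp
  have hmain : Tendsto (fun n : ℕ => a / 2 + a / 2 * (n : ℝ)⁻¹) atTop (𝓝 (a / 2)) := by
    simpa using (tendsto_inv_atTop_nhds_zero_nat (𝕜 := ℝ)).const_mul (a / 2) |>.const_add (a / 2)
  have h := hmain.add herr
  rw [add_zero] at h
  refine h.congr' ?_
  filter_upwards [eventually_gt_atTop 0] with n hn
  have hn' : (n : ℝ) ≠ 0 := by exact_mod_cast hn.ne'
  simp only [mul_sub, Finset.sum_sub_distrib, ← Finset.sum_mul, hsum]
  field_simp
  ring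

lemma L2_inner_eq {μ : Measure X} {F G : Lp ℝ 2 μ} {f g : X → ℝ} (hF : F =ᵐ[μ] f)
    (hG : G =ᵐ[μ] g) : inner ℝ F G = ∫ x, f x * g x ∂μ := by
  rw [L2.inner_def]
  refine integral_congr_ae ?_
  filter_upwards [hF, hG] with x hx hx'
  rw [hx, hx', mul_comm]
  rfl

lemma L2_integrable_mul {μ : Measure X} {F G : Lp ℝ 2 μ} {f g : X → ℝ} (hF : F =ᵐ[μ] f)
    (hG : G =ᵐ[μ] g) : Integrable (fun x => f x * g x) μ := by
  refine (L2.integrable_inner (𝕜 := ℝ) F G).congr ?_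
  filter_upwards [hF, hG] with x hx hx'
  rw [hx, hx', mul_comm]
  rfl

lemma lintegral_sq_eq_norm {μ : Measure X} {F : Lp ℝ 2 μ} {f : X → ℝ} (hF : F =ᵐ[μ] f) :
    ∫⁻ x, ENNReal.ofReal (f x ^ 2) ∂μ = ENNReal.ofReal (‖F‖ ^ 2) := by
  have h := L2_integrable_mul hF hF
  rw [← real_inner_self_eq_norm_sq, L2_inner_eq hF hF,
    ofReal_integral_eq_lintegral_ofReal h (ae_of_all _ fun x => mul_self_nonneg _)]
  simp only [pow_two]

section Invariant

variable {μ : Measure X} [IsFiniteMeasure μ] [IsMarkovKernel P]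

/-- Mean ergodic theorem for the chain started from the finite invariant measure `μ`: its
ergodic averages converge in mean square to a function of the starting point. -/
lemma exists_L2_limit (hφ : BddMeas φ) (hμ : μ.bind P = μ) :
    ∃ g : X → ℝ, Measurable g ∧ (∀ᵐ p ∂(μ ⊗ₘ P), g p.1 = g p.2) ∧
      Tendsto (fun n : ℕ => ∫⁻ x, ENNReal.ofReal (((n : ℝ)⁻¹ * sumMean P φ n x - g x) ^ 2) ∂μ)
        atTop (𝓝 0) ∧
      Tendsto (fun n : ℕ => ∫⁻ x, ENNReal.ofReal (((n : ℝ) ^ 2)⁻¹) *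
        shiftedSq P φ n (x, -(n * g x)) ∂μ) atTop (𝓝 0) := by
  obtain ⟨T, hT, hTmean, hTfix⟩ := exists_L2_operator hμ
  let Φ : Lp ℝ 2 μ := (hφ.memLp μ 2).toLp φ
  let K := T.eqLocus (1 : Lp ℝ 2 μ →L[ℝ] Lp ℝ 2 μ)
  let G : Lp ℝ 2 μ := K.orthogonalProjectionOnto Φ
  have havg : Tendsto (fun n => birkhoffAverage ℝ T _root_.id n Φ) atTop (𝓝 G) :=
    T.tendsto_birkhoffAverage_orthogonalProjection hT Φ
  have hΦG : inner ℝ Φ G = ‖G‖ ^ 2 := by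
    rw [← real_inner_self_eq_norm_sq]
    exact (Submodule.inner_orthogonalProjectionOnto_eq_of_mem_right
      (K.orthogonalProjectionOnto Φ) Φ).symm
  have hG : T G = G := (K.orthogonalProjectionOnto Φ).2
  have hΦae : Φ =ᵐ[μ] φ := (hφ.memLp μ 2).coeFn_toLp
  have hS : ∀ n, birkhoffSum T _root_.id n Φ
      = ((bddMeas_sumMean (P := P) hφ n).memLp μ 2).toLp (sumMean P φ n) := by
    intro n
    induction n with
    | zero => rfl
    | succ n ih =>
      have : birkhoffSum T _root_.id (n + 1) Φ = Φ + T (birkhoffSum T _root_.id n Φ) := by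
        rw [birkhoffSum_succ', birkhoffSum, birkhoffSum, map_sum]
        congr 1
        refine Finset.sum_congr rfl fun k _ => ?_
        exact (Function.iterate_succ_apply T k Φ).symm.trans
          (Function.iterate_succ_apply' T k Φ)
      rw [this, ih, hTmean _ (bddMeas_sumMean hφ n)]
      rfl
  have hSae : ∀ n, (birkhoffSum T _root_.id n Φ : Lp ℝ 2 μ) =ᵐ[μ] sumMean P φ n := fun n => by
    rw [hS]; exact MemLp.coeFn_toLp _
  have hAae : ∀ n : ℕ, (birkhoffAverage ℝ T _root_.id n Φ : Lp ℝ 2 μ)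
      =ᵐ[μ] fun x => (n : ℝ)⁻¹ * sumMean P φ n x := fun n => by
    filter_upwards [hSae n, Lp.coeFn_smul (n : ℝ)⁻¹ (birkhoffSum T _root_.id n Φ)] with x hx hx'
    rw [birkhoffAverage, hx', Pi.smul_apply, hx, smul_eq_mul]
  refine ⟨G, (Lp.stronglyMeasurable G).measurable, hTfix G hG, ?_, ?_⟩
  · have h0 : Tendsto (fun n => ENNReal.ofReal
        (‖birkhoffAverage ℝ T _root_.id n Φ - G‖ ^ 2)) atTop (𝓝 0) := by
      simpa using ENNReal.tendsto_ofReal ((havg.sub_const G).norm.pow 2)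
    refine h0.congr fun n => (lintegral_sq_eq_norm ?_).symm
    filter_upwards [hAae n, Lp.coeFn_sub (birkhoffAverage ℝ T _root_.id n Φ) G] with x hx hx'
    rw [hx', Pi.sub_apply, hx]
  · have hW : ∀ n, ∫ x, sumSq P φ n x ∂μ = 2 * ∑ k ∈ Finset.range n, ((k : ℝ) + 1) *
        inner ℝ Φ (birkhoffAverage ℝ T _root_.id (k + 1) Φ) - n * ‖Φ‖ ^ 2 := by
      intro n
      induction n with
      | zero => simp [sumSq]
      | succ n ih =>
        have ha := bddMeas_sumMean (P := P) hφ (n + 1)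
        have hs := bddMeas_sumSq (P := P) hφ n
        have hrec : ∀ x, sumSq P φ (n + 1) x
            = 2 * (φ x * sumMean P φ (n + 1) x) - φ x * φ x + mean P (sumSq P φ n) x := by
          intro x
          simp only [sumSq, sumMean]
          ring
        have hi := ((hφ.mul ha).integrable μ).const_mul 2
        have hinner : ((n : ℝ) + 1) * inner ℝ Φ (birkhoffAverage ℝ T _root_.id (n + 1) Φ)
            = ∫ x, φ x * sumMean P φ (n + 1) x ∂μ := by
          rw [birkhoffAverage, inner_smul_right, L2_inner_eq hΦae (hSae _), ← mul_assoc]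
          push_cast
          rw [mul_inv_cancel₀ (by positivity), one_mul]
        have hi' : Integrable (fun x => 2 * (φ x * sumMean P φ (n + 1) x) - φ x * φ x) μ :=
          hi.sub ((hφ.mul hφ).integrable μ)
        simp_rw [hrec]
        rw [integral_add hi' ((hs.mean P).integrable μ),
          integral_sub hi ((hφ.mul hφ).integrable μ), integral_const_mul, integral_mean hs hμ, ih,
          Finset.sum_range_succ, hinner, ← L2_inner_eq hΦae hΦae, real_inner_self_eq_norm_sq]
        push_cast
        ring
    have hlim : Tendsto (fun n : ℕ => ‖G‖ ^ 2
        - 2 * inner ℝ G (birkhoffAverage ℝ T _root_.id n Φ)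
        + (2 * (((n : ℝ) ^ 2)⁻¹ * ∑ k ∈ Finset.range n, ((k : ℝ) + 1) *
          inner ℝ Φ (birkhoffAverage ℝ T _root_.id (k + 1) Φ)) - (n : ℝ)⁻¹ * ‖Φ‖ ^ 2))
        atTop (𝓝 0) := by
      have h1 : Tendsto (fun n => inner ℝ G (birkhoffAverage ℝ T _root_.id n Φ))
          atTop (𝓝 (‖G‖ ^ 2)) := by
        rw [← real_inner_self_eq_norm_sq]
        exact tendsto_const_nhds.inner havg
      have h2 : Tendsto (fun n => inner ℝ Φ (birkhoffAverage ℝ T _root_.id n Φ))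
          atTop (𝓝 (‖G‖ ^ 2)) := by
        rw [← hΦG]
        exact tendsto_const_nhds.inner havg
      have h := ((h1.const_mul 2).const_sub (‖G‖ ^ 2)).add
        (((tendsto_weighted_average h2).const_mul 2).sub
          ((tendsto_inv_atTop_nhds_zero_nat (𝕜 := ℝ)).mul_const (‖Φ‖ ^ 2)))
      convert h using 2
      ring
    have hlim' := ENNReal.tendsto_ofReal hlim
    rw [ENNReal.ofReal_zero] at hlim'
    refine hlim'.congr' ?_
    filter_upwards [eventually_gt_atTop 0] with n hn
    have hn' : (n : ℝ) ≠ 0 := by exact_mod_cast hn.ne'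
    have hGae : G =ᵐ[μ] fun x => G x := ae_eq_rfl
    have i1 := L2_integrable_mul hGae hGae
    have i2 := (L2_integrable_mul hGae (hAae n)).const_mul 2
    have i12 : Integrable
        (fun x => G x * G x - 2 * (G x * ((n : ℝ)⁻¹ * sumMean P φ n x))) μ := i1.sub i2
    have i3 := ((bddMeas_sumSq (P := P) hφ n).integrable μ).const_mul ((n : ℝ) ^ 2)⁻¹
    have hpt : ∀ x, ((n : ℝ) ^ 2)⁻¹ *
        ((-(n * G x)) ^ 2 + 2 * (-(n * G x)) * sumMean P φ n x + sumSq P φ n x)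
        = G x * G x - 2 * (G x * ((n : ℝ)⁻¹ * sumMean P φ n x))
          + ((n : ℝ) ^ 2)⁻¹ * sumSq P φ n x := by
      intro x
      field_simp
      ring
    have hnn : ∀ x, 0 ≤ G x * G x - 2 * (G x * ((n : ℝ)⁻¹ * sumMean P φ n x))
        + ((n : ℝ) ^ 2)⁻¹ * sumSq P φ n x := fun x => by
      rw [← hpt]
      exact mul_nonneg (by positivity) (shiftedSq_eq hφ n x _).1
    have hval : ∫ x, (G x * G x - 2 * (G x * ((n : ℝ)⁻¹ * sumMean P φ n x))
        + ((n : ℝ) ^ 2)⁻¹ * sumSq P φ n x) ∂μ = ‖G‖ ^ 2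
        - 2 * inner ℝ G (birkhoffAverage ℝ T _root_.id n Φ)
        + (2 * (((n : ℝ) ^ 2)⁻¹ * ∑ k ∈ Finset.range n, ((k : ℝ) + 1) *
          inner ℝ Φ (birkhoffAverage ℝ T _root_.id (k + 1) Φ)) - (n : ℝ)⁻¹ * ‖Φ‖ ^ 2) := by
      rw [integral_add i12 i3, integral_sub i1 i2, integral_const_mul, integral_const_mul,
        hW, ← L2_inner_eq hGae hGae, ← L2_inner_eq hGae (hAae n), real_inner_self_eq_norm_sq]
      field_simp
    rw [← hval, ofReal_integral_eq_lintegral_ofReal (by exact i12.add i3) (ae_of_all _ hnn)]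
    refine lintegral_congr fun x => ?_
    rw [(shiftedSq_eq hφ n x _).2, ← ENNReal.ofReal_mul (by positivity), hpt]

end Invariant

lemma abs_sumMean_le [IsMarkovKernel P] {C : ℝ} (hC : ∀ x, |φ x| ≤ C) (n : ℕ) (x : X) :
    |sumMean P φ n x| ≤ n * C := by
  induction n generalizing x with
  | zero => simp [sumMean]
  | succ n ih =>
    have h : |mean P (sumMean P φ n) x| ≤ n * C := by
      simpa [mean] using
        norm_integral_le_of_norm_le_const (μ := P x) (f := sumMean P φ n) (ae_of_all _ ih)
    calc |sumMean P φ (n + 1) x| ≤ |φ x| + |mean P (sumMean P φ n) x| := abs_add_le _ _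
      _ ≤ C + n * C := add_le_add (hC x) h
      _ = (n + 1 : ℕ) * C := by push_cast; ring

lemma integral_sumMean [IsMarkovKernel P] {μ : Measure X} [IsFiniteMeasure μ] (hφ : BddMeas φ)
    (hμ : μ.bind P = μ) (n : ℕ) : ∫ x, sumMean P φ n x ∂μ = n * ∫ x, φ x ∂μ := by
  induction n with
  | zero => simp [sumMean]
  | succ n ih =>
    have hs := bddMeas_sumMean (P := P) hφ n
    simp only [sumMean]
    rw [integral_add (hφ.integrable μ) ((hs.mean P).integrable μ), integral_mean hs hμ, ih]
    push_cast
    ring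

lemma tendsto_of_tsum_sq_ne_top {u : ℕ → ℝ} {a : ℝ}
    (h : ∑' k, ENNReal.ofReal ((u k - a) ^ 2) ≠ ∞) : Tendsto u atTop (𝓝 a) := by
  have h0 := (ENNReal.tendsto_toReal ENNReal.zero_ne_top).comp
    (ENNReal.tendsto_atTop_zero_of_tsum_ne_top h)
  have h1 : Tendsto (fun k => |u k - a|) atTop (𝓝 0) := by
    have := h0.sqrt
    simpa [Function.comp_def, ENNReal.toReal_ofReal, sq_nonneg, Real.sqrt_sq_eq_abs] using this
  exact tendsto_sub_nhds_zero_iff.1 ((tendsto_zero_iff_abs_tendsto_zero _).2 h1)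

lemma ae_tsum_ne_top {Ω : Type*} [MeasurableSpace Ω] {μ : Measure Ω} {F : ℕ → Ω → ℝ≥0∞}
    (hF : ∀ k, Measurable (F k)) (h : ∑' k, ∫⁻ ω, F k ω ∂μ ≠ ∞) :
    ∀ᵐ ω ∂μ, ∑' k, F k ω ≠ ∞ := by
  rw [← lintegral_tsum fun k => (hF k).aemeasurable] at h
  filter_upwards [ae_lt_top (Measurable.tsum hF) h] with ω hω using hω.ne

lemma exists_subseq_tsum_ne_top {b c : ℕ → ℝ≥0∞} (hb : Tendsto b atTop (𝓝 0))
    (hc : Tendsto c atTop (𝓝 0)) :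
    ∃ ns : ℕ → ℕ, StrictMono ns ∧ (∀ k, 0 < ns k) ∧ ∑' k, b (ns k) ≠ ∞ ∧
      ∑' k, c (ns k) ≠ ∞ := by
  have hpos : ∀ k : ℕ, (0 : ℝ≥0∞) < 2⁻¹ ^ k := fun k =>
    ENNReal.pow_pos (by simp) k
  obtain ⟨ns, hns, h⟩ := extraction_forall_of_eventually
    (P := fun k n => 0 < n ∧ b n ≤ 2⁻¹ ^ k ∧ c n ≤ 2⁻¹ ^ k) fun k =>
      (eventually_gt_atTop 0).and
        (((hb.eventually_lt_const (hpos k)).mono fun _ h => h.le).and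
          ((hc.eventually_lt_const (hpos k)).mono fun _ h => h.le))
  have hgeom : ∑' k : ℕ, (2⁻¹ : ℝ≥0∞) ^ k ≠ ∞ := by
    rw [ENNReal.tsum_geometric, ENNReal.one_sub_inv_two, inv_inv]
    exact ENNReal.ofNat_ne_top
  exact ⟨ns, hns, fun k => (h k).1,
    ne_top_of_le_ne_top hgeom (ENNReal.tsum_le_tsum fun k => (h k).2.1),
    ne_top_of_le_ne_top hgeom (ENNReal.tsum_le_tsum fun k => (h k).2.2)⟩

/-- A subsequence of the ergodic averages of the chain converges almost surely, for almost every
starting point, to a function of the starting point which is constant along transitions. -/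
lemma exists_ae_limit [IsMarkovKernel P] {μ : Measure X} [IsFiniteMeasure μ] (hφ : BddMeas φ)
    (hμ : μ.bind P = μ) :
    ∃ (g : X → ℝ) (ns : ℕ → ℕ), Measurable g ∧ StrictMono ns ∧ (∀ k, 0 < ns k) ∧
      (∀ᵐ p ∂(μ ⊗ₘ P), g p.1 = g p.2) ∧
      (∀ᵐ x ∂μ, Tendsto (fun k => (ns k : ℝ)⁻¹ * sumMean P φ (ns k) x) atTop (𝓝 (g x))) ∧
      ∀ᵐ x ∂μ, ∀ m, IsTrajLaw P (Measure.dirac x) m →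
        ∀ᵐ ω ∂m, Tendsto (fun k => (ns k : ℝ)⁻¹ * ∑ i ∈ Finset.range (ns k), φ (ω i))
          atTop (𝓝 (g x)) := by
  obtain ⟨g, hg, hgP, hb, hc⟩ := exists_L2_limit hφ hμ
  obtain ⟨ns, hns, hpos, hb', hc'⟩ := exists_subseq_tsum_ne_top hb hc
  have hφm := hφ.1
  refine ⟨g, ns, hg, hns, hpos, hgP, ?_, ?_⟩
  · have hm : ∀ k, Measurable (fun x =>
        ENNReal.ofReal (((ns k : ℝ)⁻¹ * sumMean P φ (ns k) x - g x) ^ 2)) := fun k => by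
      have := (bddMeas_sumMean (P := P) hφ (ns k)).1
      fun_prop
    filter_upwards [ae_tsum_ne_top hm hb'] with x hx using tendsto_of_tsum_sq_ne_top hx
  · have hm : ∀ k, Measurable (fun x => ENNReal.ofReal (((ns k : ℝ) ^ 2)⁻¹) *
        shiftedSq P φ (ns k) (x, -(ns k * g x))) := fun k => by
      have := measurable_shiftedSq (P := P) hφm (ns k)
      fun_prop
    filter_upwards [ae_tsum_ne_top hm hc'] with x hx m hm
    have hval : ∀ k, ∫⁻ ω, ENNReal.ofReal (((ns k : ℝ)⁻¹ * ∑ i ∈ Finset.range (ns k), φ (ω i)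
        - g x) ^ 2) ∂m = ENNReal.ofReal (((ns k : ℝ) ^ 2)⁻¹) *
          shiftedSq P φ (ns k) (x, -(ns k * g x)) := by
      intro k
      have hk : (ns k : ℝ) ≠ 0 := by exact_mod_cast (hpos k).ne'
      rw [← hm.lintegral_sq hφm, ← lintegral_const_mul _ (by fun_prop)]
      refine lintegral_congr fun ω => ?_
      rw [← ENNReal.ofReal_mul (by positivity)]
      congr 1
      field_simp
      ring
    simp_rw [← hval] at hx
    filter_upwards [ae_tsum_ne_top (fun k => by fun_prop) hx] with ω hω
      using tendsto_of_tsum_sq_ne_top hω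

/-- The restriction of an invariant measure to a set which is almost surely preserved in both
directions by the transitions is invariant. -/
lemma bind_restrict_eq [IsMarkovKernel P] {μ : Measure X} [IsFiniteMeasure μ]
    (hμ : μ.bind P = μ) {B : Set X} (hB : MeasurableSet B)
    (h : ∀ᵐ p ∂(μ ⊗ₘ P), p.1 ∈ B ↔ p.2 ∈ B) : (μ.restrict B).bind P = μ.restrict B := by
  ext E hE
  rw [Measure.bind_apply hE P.measurable.aemeasurable, Measure.restrict_apply hE,
    ← Measure.compProd_apply_prod hB hE,
    ← (measurePreserving_snd_compProd hμ).measure_preimage (hE.inter hB).nullMeasurableSet]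
  refine measure_congr ?_
  filter_upwards [h] with p hp
  refine propext ⟨fun hp' => ⟨hp'.2, hp.1 hp'.1⟩, fun hp' => ⟨hp.2 hp'.2, hp'.1⟩⟩

lemma tendsto_average_sub {X : Type*} [PseudoMetricSpace X] {φ : X → ℝ}
    (hφ : UniformContinuous φ) {p : (ℕ → X) × (ℕ → X)} (hp : p ∈ diagInf X) :
    Tendsto (fun n : ℕ => (n : ℝ)⁻¹ * ∑ i ∈ Finset.range n, φ (p.1 i)
      - (n : ℝ)⁻¹ * ∑ i ∈ Finset.range n, φ (p.2 i)) atTop (𝓝 0) := by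
  have h : Tendsto (fun i => φ (p.1 i) - φ (p.2 i)) atTop (𝓝 0) := by
    rw [tendsto_zero_iff_norm_tendsto_zero]
    simp_rw [Real.norm_eq_abs, ← Real.dist_eq]
    have h' := Filter.Tendsto.comp hφ (tendsto_uniformity_iff_dist_tendsto_zero
      (f := fun i => (p.1 i, p.2 i)) |>.2 hp)
    exact tendsto_uniformity_iff_dist_tendsto_zero.1 h'
  simpa [mul_sub] using h.cesaro

lemma integral_eq_of_generalized_coupling {X : Type*} [PseudoMetricSpace X] [MeasurableSpace X]
    {P : Kernel X X} [IsMarkovKernel P] {A : Set X}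
    (hA_pos : ∀ μ : Measure X, IsProbabilityMeasure μ → μ.bind P = μ → 0 < μ A)
    {Γ : X → X → Measure ((ℕ → X) × (ℕ → X))}
    (hΓ_cpl : ∀ x ∈ A, ∀ y ∈ A,
      (∃ m₁, IsTrajLaw P (Measure.dirac x) m₁ ∧ (Γ x y).map Prod.fst ≪ m₁) ∧
      (∃ m₂, IsTrajLaw P (Measure.dirac y) m₂ ∧ (Γ x y).map Prod.snd ≪ m₂))
    (hΓ_diag : ∀ x ∈ A, ∀ y ∈ A, 0 < Γ x y (diagInf X))
    {μ₁ μ₂ : Measure X} [IsProbabilityMeasure μ₁] [IsProbabilityMeasure μ₂]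
    (h₁ : μ₁.bind P = μ₁) (h₂ : μ₂.bind P = μ₂)
    {φ : X → ℝ} (hφ : BddMeas φ) (hφu : UniformContinuous φ) :
    ∫ x, φ x ∂μ₁ = ∫ x, φ x ∂μ₂ := by
  have hμ : (μ₁ + μ₂).bind P = μ₁ + μ₂ := by rw [Measure.comp_add, h₁, h₂]
  obtain ⟨g, ns, hg, hns, hpos, hgP, hmean, htraj⟩ := exists_ae_limit hφ hμ
  set μ := μ₁ + μ₂
  let good : Set X := {x | ∀ m, IsTrajLaw P (Measure.dirac x) m →
    ∀ᵐ ω ∂m, Tendsto (fun k => (ns k : ℝ)⁻¹ * ∑ i ∈ Finset.range (ns k), φ (ω i))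
      atTop (𝓝 (g x))}
  have hconst : ∀ x ∈ A, x ∈ good → ∀ y ∈ A, y ∈ good → g x = g y := by
    intro x hxA hx y hyA hy
    obtain ⟨⟨m₁, hm₁, hac₁⟩, ⟨m₂, hm₂, hac₂⟩⟩ := hΓ_cpl x hxA y hyA
    have e₁ := ae_of_ae_map measurable_fst.aemeasurable (hac₁.ae_le (hx m₁ hm₁))
    have e₂ := ae_of_ae_map measurable_snd.aemeasurable (hac₂.ae_le (hy m₂ hm₂))
    obtain ⟨p, hp, hp₁, hp₂⟩ := Measure.exists_mem_of_measure_ne_zero_of_ae (hΓ_diag x hxA y hyA).ne'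
      (ae_restrict_of_ae (e₁.and e₂))
    have h0 := (tendsto_average_sub hφu hp).comp hns.tendsto_atTop
    exact sub_eq_zero.1 (tendsto_nhds_unique (hp₁.sub hp₂) h0)
  have hμA : μ A ≠ 0 := fun h => (hA_pos μ₁ inferInstance h₁).ne'
    (le_antisymm ((Measure.le_add_right le_rfl A).trans h.le) zero_le)
  obtain ⟨x₀, hx₀A, hx₀⟩ := Measure.exists_mem_of_measure_ne_zero_of_ae hμA (ae_restrict_of_ae htraj)
  let B : Set X := {x | g x ≠ g x₀}
  have hB : MeasurableSet B := (hg (measurableSet_singleton (g x₀))).compl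
  have hBA : μ (A ∩ B) = 0 := measure_mono_null
    (fun x hx hx' => hx.2 (hconst x hx.1 hx' x₀ hx₀A hx₀)) htraj
  have hB0 : μ B = 0 := by
    by_contra hB0
    have hprob : IsProbabilityMeasure (μ[|B]) := cond_isProbabilityMeasure hB0
    have hinv : (μ[|B]).bind P = μ[|B] := by
      rw [ProbabilityTheory.cond, Measure.bind_smul, bind_restrict_eq hμ hB]
      filter_upwards [hgP] with p hp
      simp only [B, Set.mem_ofPred_eq, hp]
    refine (hA_pos _ hprob hinv).ne' ?_
    rw [cond_apply hB, Set.inter_comm, hBA, mul_zero]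
  have hgc : ∀ᵐ x ∂μ, g x = g x₀ := by
    filter_upwards [measure_eq_zero_iff_ae_notMem.1 hB0] with x hx using not_not.1 hx
  obtain ⟨C, hC⟩ := hφ.2
  have key : ∀ (ν : Measure X) [IsProbabilityMeasure ν], ν.bind P = ν → ν ≪ μ →
      ∫ x, φ x ∂ν = g x₀ := by
    intro ν _ hν hνμ
    have hlim : Tendsto (fun k => ∫ x, (ns k : ℝ)⁻¹ * sumMean P φ (ns k) x ∂ν) atTop
        (𝓝 (∫ _, g x₀ ∂ν)) := by
      refine tendsto_integral_of_dominated_convergence (fun _ => C) (fun k =>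
        ((bddMeas_sumMean hφ (ns k)).1.const_mul _).aestronglyMeasurable)
        (integrable_const C) (fun k => ae_of_all _ fun x => ?_) ?_
      · have hk : (0 : ℝ) < ns k := by exact_mod_cast hpos k
        rw [norm_mul, norm_inv, Real.norm_natCast, inv_mul_le_iff₀ hk]
        exact abs_sumMean_le hC _ x
      · filter_upwards [hνμ.ae_le hmean, hνμ.ae_le hgc] with x hx hx'
        rwa [← hx']
    have hk : ∀ k, ∫ x, (ns k : ℝ)⁻¹ * sumMean P φ (ns k) x ∂ν = ∫ x, φ x ∂ν := by
      intro k
      have hk : (ns k : ℝ) ≠ 0 := by exact_mod_cast (hpos k).ne'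
      rw [integral_const_mul, integral_sumMean hφ hν, inv_mul_cancel_left₀ hk]
    simp only [hk, integral_const, probReal_univ, one_smul] at hlim
    exact tendsto_nhds_unique tendsto_const_nhds hlim
  rw [key μ₁ h₁ (Measure.le_add_right le_rfl).absolutelyContinuous,
    key μ₂ h₂ (Measure.le_add_left le_rfl).absolutelyContinuous]

lemma ext_of_forall_integral_uniformContinuous {X : Type*} [PseudoEMetricSpace X]
    [MeasurableSpace X] [BorelSpace X] {μ ν : Measure X} [IsProbabilityMeasure μ]
    [IsProbabilityMeasure ν]
    (h : ∀ φ : X → ℝ, BddMeas φ → UniformContinuous φ → ∫ x, φ x ∂μ = ∫ x, φ x ∂ν) : μ = ν := by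
  refine ext_of_generate_finite _
    (BorelSpace.measurable_eq.trans borel_eq_generateFrom_isClosed) isPiSystem_isClosed
    (fun F hF => ?_) (by simp)
  have hδ : ∀ n : ℕ, (0 : ℝ) < 1 / ((n : ℝ) + 1) := fun n => by positivity
  have hlim := tendsto_one_div_add_atTop_nhds_zero_nat (𝕜 := ℝ)
  have hμ := tendsto_integral_thickenedIndicator_of_isClosed μ hF hδ hlim
  have hν := tendsto_integral_thickenedIndicator_of_isClosed ν hF hδ hlim
  have heq : ∀ n, ∫ x, (thickenedIndicator (hδ n) F x : ℝ) ∂μ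
      = ∫ x, (thickenedIndicator (hδ n) F x : ℝ) ∂ν := fun n =>
    h _ ⟨by fun_prop, 1, fun x => by simpa using thickenedIndicator_le_one (hδ n) F x⟩
      (NNReal.isometry_coe.uniformContinuous.comp
        (lipschitzWith_thickenedIndicator (hδ n) F).uniformContinuous)
  simp_rw [heq] at hμ
  exact (measureReal_eq_measureReal_iff).1 (tendsto_nhds_unique hμ hν)

end MarkovAverage

/-- **Corollary 2.2.** If there is a measurable set `A` charged by every invariant
probability measure, and a measurable family of generalised couplings
`Γ_{x,y} ∈ C̃(P_[∞]δ_x, P_[∞]δ_y)` for `x, y ∈ A` giving positive mass to the diagonal at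
infinity, then `P` has at most one invariant probability measure. -/
theorem stmt_3 {X : Type*} [MetricSpace X] [CompleteSpace X] [SecondCountableTopology X]
    [MeasurableSpace X] [BorelSpace X]
    (P : Kernel X X) [IsMarkovKernel P]
    (A : Set X) (hA_meas : MeasurableSet A)
    (hA_pos : ∀ μ : Measure X, IsProbabilityMeasure μ → μ.bind (fun x => P x) = μ →
      0 < μ A)
    (Γ : X → X → Measure ((ℕ → X) × (ℕ → X)))
    -- measurability of the map `(x,y) ↦ Γ_{x,y}` on `A × A`
    (hΓ_meas : ∀ φ : ((ℕ → X) × (ℕ → X)) →ᵇ ℝ,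
      Measurable (fun p : A × A => ∫ ω, φ ω ∂(Γ (p.1 : X) (p.2 : X))))
    -- `Γ_{x,y} ∈ C̃(P_[∞]δ_x, P_[∞]δ_y)` for `x, y ∈ A`
    (hΓ_cpl : ∀ x ∈ A, ∀ y ∈ A, IsProbabilityMeasure (Γ x y) ∧
      (∃ m₁ : Measure (ℕ → X), IsTrajLaw P (Measure.dirac x) m₁ ∧
        (Γ x y).map Prod.fst ≪ m₁) ∧
      (∃ m₂ : Measure (ℕ → X), IsTrajLaw P (Measure.dirac y) m₂ ∧
        (Γ x y).map Prod.snd ≪ m₂))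
    (hΓ_diag : ∀ x ∈ A, ∀ y ∈ A, 0 < Γ x y (diagInf X)) :
    ∀ μ₁ μ₂ : Measure X, IsProbabilityMeasure μ₁ → IsProbabilityMeasure μ₂ →
      μ₁.bind (fun x => P x) = μ₁ → μ₂.bind (fun x => P x) = μ₂ → μ₁ = μ₂ := by
  intro μ₁ μ₂ hμ₁ hμ₂ h₁ h₂
  exact MarkovAverage.ext_of_forall_integral_uniformContinuous fun φ hφ hφu =>
    MarkovAverage.integral_eq_of_generalized_coupling hA_pos
      (fun x hx y hy => (hΓ_cpl x hx y hy).2) hΓ_diag h₁ h₂ hφ hφu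
end
end

section
/- Let {P_t}_{t≥0} be a Markov semigroup over a Polish space X admitting a continuous Lyapunov function V with constants C_V, γ, K_V. Suppose there exist t★ > 0 and a distance-like function d: X×X → [0,1] which is contracting for P_{t★} and such that the level set {x ∈ X : V(x) ≤ 4K_V} is d-small for P_{t★}. Then {P_t} has at most one invariant probability measure; moreover, defining d̃(x,y) = √(d(x,y)(1 + V(x) + V(y))), there exists t > 0 such that the lifted distance satisfies d̃(P_t μ, P_t ν) ≤ (1/2) d̃(μ,ν) for all probability measures μ and ν on X. -/
open MeasureTheory ProbabilityTheory Filter Topology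
open scoped ENNReal NNReal

noncomputable section

/-- The lift of a distance-like function `d` to probability measures, defined as the infimum
over couplings of the integral of `d`. -/
def liftDist {α : Type*} [MeasurableSpace α] (d : α → α → ℝ) (μ ν : Measure α) : ℝ≥0∞ :=
  sInf {r : ℝ≥0∞ | ∃ π : Measure (α × α), IsCoupling π μ ν ∧
    r = ∫⁻ p, ENNReal.ofReal (d p.1 p.2) ∂π}

section

open scoped BoundedContinuousFunction

/-- A nonnegative lower semicontinuous function on a space `Y` embedded in a pseudometrizable space
`Z` is the increasing limit of continuous functions defined on the whole of `Z`. -/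
theorem LowerSemicontinuous.exists_continuous_tendsto_comp {Y Z : Type*} [TopologicalSpace Y]
    [Nonempty Y] [TopologicalSpace Z] [TopologicalSpace.PseudoMetrizableSpace Z] {j : Y → Z}
    (hj : IsInducing j) {c : Y → ℝ} (hc : LowerSemicontinuous c) (hc0 : ∀ y, 0 ≤ c y) :
    ∃ h : ℕ → Z → ℝ, (∀ n, Continuous (h n)) ∧ (∀ n z, 0 ≤ h n z) ∧ (∀ z, Monotone (h · z)) ∧
      (∀ n y, h n (j y) ≤ c y) ∧ ∀ y, Tendsto (fun n => h n (j y)) atTop (𝓝 (c y)) := by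
  let := TopologicalSpace.pseudoMetrizableSpacePseudoMetric Z
  have hnn (n : ℕ) (z : Z) (y : Y) : 0 ≤ min (c y) n + n * dist z (j y) := by
    have := hc0 y
    positivity
  have hbdd (n : ℕ) (z : Z) : BddBelow (Set.range fun y => min (c y) n + n * dist z (j y)) :=
    ⟨0, by rintro _ ⟨y, rfl⟩; exact hnn n z y⟩
  have hle (n : ℕ) (y : Y) : ⨅ q, (min (c q) n + n * dist (j y) (j q)) ≤ c y :=
    (ciInf_le (hbdd n (j y)) y).trans (by simp)
  refine ⟨fun n z => ⨅ y, (min (c y) n + n * dist z (j y)), fun n => ?_, fun n z => ?_,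
    fun z m n hmn => ?_, hle, fun y => ?_⟩
  · refine LipschitzWith.continuous (K := n) (LipschitzWith.of_le_add_mul _ fun z w => ?_)
    rw [← sub_le_iff_le_add]
    refine le_ciInf fun y => ?_
    have h1 := ciInf_le (hbdd n z) y
    have h2 : (n : ℝ) * dist z (j y) ≤ n * (dist z w + dist w (j y)) := by
      gcongr
      exact dist_triangle _ _ _
    simp only [NNReal.coe_natCast]
    linarith
  · exact Real.iInf_nonneg (hnn n z)
  · refine ciInf_mono (hbdd m z) fun y => ?_
    have : (m : ℝ) ≤ n := mod_cast hmn
    gcongr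
  · refine tendsto_order.2 ⟨fun a ha => ?_, fun a ha => .of_forall fun n => (hle n y).trans_lt ha⟩
    obtain ⟨b, hab, hb⟩ := exists_between ha
    have hnear : ∀ᶠ q in 𝓝 y, b < c q := hc y b hb
    rw [hj.nhds_eq_comap, (Metric.nhds_basis_ball.comap _).eventually_iff] at hnear
    obtain ⟨δ, hδ, hball⟩ := hnear
    have hlarge : ∀ᶠ n : ℕ in atTop, b ≤ n ∧ b ≤ n * δ :=
      (tendsto_natCast_atTop_atTop.eventually_ge_atTop b).and
        ((tendsto_natCast_atTop_atTop.atTop_mul_const hδ).eventually_ge_atTop b)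
    filter_upwards [hlarge] with n hn
    refine hab.trans_le (le_ciInf fun q => ?_)
    by_cases hq : dist (j y) (j q) < δ
    · have h1 : b < c q := hball (by simpa [dist_comm] using! hq)
      have h2 : 0 ≤ (n : ℝ) * dist (j y) (j q) := by positivity
      linarith [le_min h1.le hn.1]
    · have h1 : (n : ℝ) * δ ≤ n * dist (j y) (j q) := by
        gcongr
        exact not_lt.1 hq
      have h2 : 0 ≤ min (c q) n := le_min (hc0 q) (by positivity)
      linarith [hn.2]

theorem IsCoupling.isProbabilityMeasure {α β : Type*} [MeasurableSpace α] [MeasurableSpace β]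
    {π : Measure (α × β)} {μ : Measure α} {ν : Measure β} [IsProbabilityMeasure μ]
    (h : IsCoupling π μ ν) : IsProbabilityMeasure π := by
  have : IsProbabilityMeasure (π.map Prod.fst) := h.1 ▸ inferInstance
  exact Measure.isProbabilityMeasure_of_map Prod.fst

theorem isCoupling_prod {α β : Type*} [MeasurableSpace α] [MeasurableSpace β]
    (μ : Measure α) (ν : Measure β) [IsProbabilityMeasure μ] [IsProbabilityMeasure ν] :
    IsCoupling (μ.prod ν) μ ν := by
  constructor <;> simp

theorem IsCoupling.liftDist_le {α : Type*} [MeasurableSpace α] {d : α → α → ℝ}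
    {π : Measure (α × α)} {μ ν : Measure α} (h : IsCoupling π μ ν) :
    liftDist d μ ν ≤ ∫⁻ p, ENNReal.ofReal (d p.1 p.2) ∂π :=
  sInf_le ⟨π, h, rfl⟩

theorem le_liftDist {α : Type*} [MeasurableSpace α] {d : α → α → ℝ} {μ ν : Measure α} {r : ℝ≥0∞}
    (h : ∀ π : Measure (α × α), IsCoupling π μ ν → r ≤ ∫⁻ p, ENNReal.ofReal (d p.1 p.2) ∂π) :
    r ≤ liftDist d μ ν := by
  refine le_sInf ?_
  rintro _ ⟨π, hπ, rfl⟩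
  exact h π hπ

/-- The values taken by integrals against the marginals of a probability measure on `Q × Q`,
together with all upper bounds of the integrals of a family of continuous functions. -/
def marginalIntegrals {Q : Type*} [TopologicalSpace Q] [MeasurableSpace Q]
    (h : ℕ → (Q × Q) →ᵇ ℝ) (F : Finset (Q →ᵇ ℝ)) : Set ((F → ℝ) × (F → ℝ) × ℝ) :=
  {e | ∃ ρ : ProbabilityMeasure (Q × Q), (∀ φ : F, ∫ p, φ.1 p.1 ∂(ρ : Measure (Q × Q)) = e.1 φ) ∧
    (∀ φ : F, ∫ p, φ.1 p.2 ∂(ρ : Measure (Q × Q)) = e.2.1 φ) ∧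
    ∀ n, ∫ p, h n p ∂(ρ : Measure (Q × Q)) ≤ e.2.2}

section Marginals

variable {Q : Type*} [TopologicalSpace Q] [MeasurableSpace Q] [BorelSpace Q]
  [SecondCountableTopology Q]

theorem convex_marginalIntegrals (h : ℕ → (Q × Q) →ᵇ ℝ) (F : Finset (Q →ᵇ ℝ)) :
    Convex ℝ (marginalIntegrals h F) := by
  rintro e ⟨ρ, h1, h2, h3⟩ e' ⟨ρ', h1', h2', h3'⟩ a b ha hb hab
  have hprob : IsProbabilityMeasure
      (ENNReal.ofReal a • (ρ : Measure (Q × Q)) + ENNReal.ofReal b • (ρ' : Measure (Q × Q))) :=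
    ⟨by simp [← ENNReal.ofReal_add ha hb, hab]⟩
  have key (f : (Q × Q) →ᵇ ℝ) : ∫ p, f p ∂(ENNReal.ofReal a • (ρ : Measure (Q × Q)) +
      ENNReal.ofReal b • (ρ' : Measure (Q × Q))) =
      a * ∫ p, f p ∂(ρ : Measure (Q × Q)) + b * ∫ p, f p ∂(ρ' : Measure (Q × Q)) := by
    rw [integral_add_measure ((f.integrable _).smul_measure ENNReal.ofReal_ne_top)
      ((f.integrable _).smul_measure ENNReal.ofReal_ne_top), integral_smul_measure,
      integral_smul_measure, ENNReal.toReal_ofReal ha, ENNReal.toReal_ofReal hb]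
    rfl
  refine ⟨⟨_, hprob⟩, fun φ => ?_, fun φ => ?_, fun n => ?_⟩
  · have := key (φ.1.compContinuous ⟨Prod.fst, continuous_fst⟩)
    simp only [BoundedContinuousFunction.compContinuous_apply, ContinuousMap.coe_mk] at this
    simp [this, h1, h1']
  · have := key (φ.1.compContinuous ⟨Prod.snd, continuous_snd⟩)
    simp only [BoundedContinuousFunction.compContinuous_apply, ContinuousMap.coe_mk] at this
    simp [this, h2, h2']
  · simp only [ProbabilityMeasure.coe_mk, key, Prod.snd_add, Prod.smul_snd, smul_eq_mul]
    gcongr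
    exacts [h3 n, h3' n]

theorem isClosed_marginalIntegrals [CompactSpace Q] [T2Space Q] (h : ℕ → (Q × Q) →ᵇ ℝ)
    (F : Finset (Q →ᵇ ℝ)) : IsClosed (marginalIntegrals h F) := by
  have hcont (f : (Q × Q) →ᵇ ℝ) : Continuous fun q : ProbabilityMeasure (Q × Q) ×
      ((F → ℝ) × (F → ℝ) × ℝ) => ∫ p, f p ∂(q.1 : Measure (Q × Q)) :=
    (ProbabilityMeasure.continuous_integral_boundedContinuousFunction f).comp continuous_fst
  have hclosed : IsClosed {q : ProbabilityMeasure (Q × Q) × ((F → ℝ) × (F → ℝ) × ℝ) |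
      (∀ φ : F, ∫ p, φ.1 p.1 ∂(q.1 : Measure (Q × Q)) = q.2.1 φ) ∧
      (∀ φ : F, ∫ p, φ.1 p.2 ∂(q.1 : Measure (Q × Q)) = q.2.2.1 φ) ∧
      ∀ n, ∫ p, h n p ∂(q.1 : Measure (Q × Q)) ≤ q.2.2.2} := by
    simp only [Set.ofPred_and, Set.ofPred_forall]
    refine (isClosed_iInter fun φ => isClosed_eq ?_ (by fun_prop)).inter
      ((isClosed_iInter fun φ => isClosed_eq ?_ (by fun_prop)).inter
      (isClosed_iInter fun n => isClosed_le (hcont _) (by fun_prop)))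
    · exact hcont (φ.1.compContinuous ⟨Prod.fst, continuous_fst⟩)
    · exact hcont (φ.1.compContinuous ⟨Prod.snd, continuous_snd⟩)
  convert! isClosedMap_snd_of_compactSpace _ hclosed
  ext e
  simp [marginalIntegrals]

end Marginals

section Coupling

variable {Z Q X : Type*} [MeasurableSpace Z]

/-- Averaging couplings of `κ z` and `η z`, in a compact space: if for every `z` there are couplings
of cost arbitrarily close to `g z`, then there is a coupling of the averages of cost at most the
average of `g`. -/
theorem exists_probabilityMeasure_forall_integral_eq [TopologicalSpace Q] [MeasurableSpace Q]
    [BorelSpace Q] [SecondCountableTopology Q] [CompactSpace Q] [T2Space Q]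
    (π : Measure Z) [IsProbabilityMeasure π] (κ η : Kernel Z Q) [IsMarkovKernel κ]
    [IsMarkovKernel η] (h : ℕ → (Q × Q) →ᵇ ℝ) {g : Z → ℝ} (hg : Integrable g π)
    (hcoup : ∀ z, ∀ δ > 0, ∃ ρ : Measure (Q × Q), IsCoupling ρ (κ z) (η z) ∧
      ∀ n, ∫ p, h n p ∂ρ ≤ g z + δ) :
    ∃ ρ : ProbabilityMeasure (Q × Q),
      (∀ φ : Q →ᵇ ℝ, ∫ p, φ p.1 ∂(ρ : Measure (Q × Q)) = ∫ z, ∫ x, φ x ∂(κ z) ∂π) ∧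
      (∀ φ : Q →ᵇ ℝ, ∫ p, φ p.2 ∂(ρ : Measure (Q × Q)) = ∫ z, ∫ x, φ x ∂(η z) ∂π) ∧
      ∀ n, ∫ p, h n p ∂(ρ : Measure (Q × Q)) ≤ ∫ z, g z ∂π := by
  have hcont (f : (Q × Q) →ᵇ ℝ) : Continuous fun ρ : ProbabilityMeasure (Q × Q) =>
      ∫ p, f p ∂(ρ : Measure (Q × Q)) :=
    ProbabilityMeasure.continuous_integral_boundedContinuousFunction f
  let K (F : Finset (Q →ᵇ ℝ)) : Set (ProbabilityMeasure (Q × Q)) := {ρ |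
    (∀ φ ∈ F, ∫ p, φ p.1 ∂(ρ : Measure (Q × Q)) = ∫ z, ∫ x, φ x ∂(κ z) ∂π) ∧
    (∀ φ ∈ F, ∫ p, φ p.2 ∂(ρ : Measure (Q × Q)) = ∫ z, ∫ x, φ x ∂(η z) ∂π) ∧
    ∀ n, ∫ p, h n p ∂(ρ : Measure (Q × Q)) ≤ ∫ z, g z ∂π}
  have hKclosed (F) : IsClosed (K F) := by
    simp only [K, Set.ofPred_and, Set.ofPred_forall]
    refine (isClosed_iInter fun φ => isClosed_iInter fun _ => isClosed_eq ?_ (by fun_prop)).inter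
      ((isClosed_iInter fun φ => isClosed_iInter fun _ => isClosed_eq ?_ (by fun_prop)).inter
      (isClosed_iInter fun n => isClosed_le (hcont _) (by fun_prop)))
    · exact hcont (φ.compContinuous ⟨Prod.fst, continuous_fst⟩)
    · exact hcont (φ.compContinuous ⟨Prod.snd, continuous_snd⟩)
  have hinteg (ξ : Kernel Z Q) [IsMarkovKernel ξ] (φ : Q →ᵇ ℝ) :
      Integrable (fun z => ∫ x, φ x ∂(ξ z)) π := by
    refine Integrable.of_bound (C := ‖φ‖)
      (φ.continuous.stronglyMeasurable.integral_kernel).aestronglyMeasurable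
      (.of_forall fun z => ?_)
    simpa using φ.norm_integral_le_norm (ξ z)
  have hKne (F) : (K F).Nonempty := by
    classical
    let f : Z → (F → ℝ) × (F → ℝ) × ℝ := fun z =>
      (fun φ => ∫ x, φ.1 x ∂(κ z), fun φ => ∫ x, φ.1 x ∂(η z), g z)
    have hf1 : Integrable (fun z => (f z).1) π := Integrable.of_eval fun φ => hinteg κ φ.1
    have hf2 : Integrable (fun z => (f z).2.1) π := Integrable.of_eval fun φ => hinteg η φ.1
    have hf : Integrable f π := hf1.prodMk (hf2.prodMk hg)
    have hmem (z) : f z ∈ marginalIntegrals h F := by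
      have hlim : Tendsto (fun δ : ℝ => ((f z).1, (f z).2.1, g z + δ)) (𝓝[>] 0) (𝓝 (f z)) := by
        have : Continuous fun δ : ℝ => ((f z).1, (f z).2.1, g z + δ) := by fun_prop
        simpa [f] using! (this.tendsto 0).mono_left nhdsWithin_le_nhds
      refine (isClosed_marginalIntegrals h F).mem_of_tendsto hlim ?_
      filter_upwards [self_mem_nhdsWithin] with δ hδ
      obtain ⟨ρ, hρ, hle⟩ := hcoup z δ hδ
      refine ⟨⟨ρ, hρ.isProbabilityMeasure⟩, fun φ => ?_, fun φ => ?_, hle⟩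
      · simp only [f, ← hρ.1, ProbabilityMeasure.coe_mk]
        rw [integral_map measurable_fst.aemeasurable
          φ.1.continuous.stronglyMeasurable.aestronglyMeasurable]
      · simp only [f, ← hρ.2, ProbabilityMeasure.coe_mk]
        rw [integral_map measurable_snd.aemeasurable
          φ.1.continuous.stronglyMeasurable.aestronglyMeasurable]
    obtain ⟨ρ, h1, h2, h3⟩ := (convex_marginalIntegrals h F).integral_mem
      (isClosed_marginalIntegrals h F) (.of_forall hmem) hf
    refine ⟨ρ, fun φ hφ => ?_, fun φ hφ => ?_, fun n => ?_⟩
    · rw [h1 ⟨φ, hφ⟩, fst_integral hf]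
      exact eval_integral (fun φ : F => hinteg κ φ.1) ⟨φ, hφ⟩
    · rw [h2 ⟨φ, hφ⟩, snd_integral hf, fst_integral hf.snd]
      exact eval_integral (fun φ : F => hinteg η φ.1) ⟨φ, hφ⟩
    · refine (h3 n).trans_eq ?_
      rw [snd_integral hf, snd_integral hf.snd]
  have hKdir : Directed (· ⊇ ·) K := by
    classical
    refine fun F G => ⟨F ∪ G, fun ρ hρ => ⟨fun φ hφ => hρ.1 φ (by simp [hφ]),
      fun φ hφ => hρ.2.1 φ (by simp [hφ]), hρ.2.2⟩, fun ρ hρ => ⟨fun φ hφ => hρ.1 φ (by simp [hφ]),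
      fun φ hφ => hρ.2.1 φ (by simp [hφ]), hρ.2.2⟩⟩
  obtain ⟨ρ, hρ⟩ := IsCompact.nonempty_iInter_of_directed_nonempty_isCompact_isClosed K hKdir hKne
    (fun F => (hKclosed F).isCompact) hKclosed
  simp only [Set.mem_iInter] at hρ
  exact ⟨ρ, fun φ => (hρ {φ}).1 φ (by simp), fun φ => (hρ {φ}).2.1 φ (by simp), (hρ ∅).2.2⟩

variable [TopologicalSpace X] [PolishSpace X] [MeasurableSpace X] [BorelSpace X]

/-- Convexity of the lifted distance: the averages of two Markov kernels admit a coupling whose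
cost is at most the average of any upper bound for the lifted distances of the kernels. -/
theorem exists_isCoupling_bind_lintegral_le (π : Measure Z) [IsProbabilityMeasure π]
    (κ η : Kernel Z X) [IsMarkovKernel κ] [IsMarkovKernel η] {c : X → X → ℝ}
    (hc : LowerSemicontinuous fun p : X × X => c p.1 p.2) (hc0 : ∀ x y, 0 ≤ c x y)
    {g : Z → ℝ} (hg : Integrable g π) (hg0 : ∀ z, 0 ≤ g z)
    (hle : ∀ z, liftDist c (κ z) (η z) ≤ ENNReal.ofReal (g z)) :
    ∃ ρ : Measure (X × X), IsCoupling ρ (π.bind κ) (π.bind η) ∧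
      ∫⁻ p, ENNReal.ofReal (c p.1 p.2) ∂ρ ≤ ENNReal.ofReal (∫ z, g z ∂π) := by
  let := TopologicalSpace.upgradeIsCompletelyMetrizable X
  obtain ⟨ι, hι⟩ := Metric.PiNatEmbed.exists_embedding_to_hilbert_cube (X := X)
  have hιm : MeasurableEmbedding ι := hι.continuous.measurableEmbedding hι.injective
  have hj : IsEmbedding (Prod.map ι ι) := hι.prodMap hι
  have hjm : MeasurableEmbedding (Prod.map ι ι) :=
    hj.continuous.measurableEmbedding hj.injective
  have : Nonempty X := by
    obtain ⟨z⟩ := π.nonempty_of_neZero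
    exact (κ z).nonempty_of_neZero
  obtain ⟨h, hcont, hh0, hmono, hhle, hlim⟩ := hc.exists_continuous_tendsto_comp hj.isInducing
    fun p => hc0 p.1 p.2
  let h' (n : ℕ) : ((ℕ → unitInterval) × (ℕ → unitInterval)) →ᵇ ℝ :=
    BoundedContinuousFunction.mkOfCompact ⟨h n, hcont n⟩
  have := Kernel.IsMarkovKernel.map κ hιm.measurable
  have := Kernel.IsMarkovKernel.map η hιm.measurable
  have hbind (ξ : Kernel Z X) [IsMarkovKernel ξ] (ν : Measure (ℕ → unitInterval))
      [IsProbabilityMeasure ν]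
      (hν : ∀ φ : (ℕ → unitInterval) →ᵇ ℝ, ∫ q, φ q ∂ν = ∫ z, ∫ x, φ x ∂(ξ.map ι z) ∂π) :
      ν = (π.bind ξ).map ι := by
    have := Kernel.IsMarkovKernel.map ξ hιm.measurable
    rw [Measure.map_comp _ _ hιm.measurable]
    refine ext_of_forall_integral_eq_of_IsFiniteMeasure fun φ => ?_
    rw [hν, Measure.comp_eq_comp_const_apply, Kernel.integral_comp (φ.integrable _),
      Kernel.const_apply]
  obtain ⟨⟨ρ, _⟩, hρ1, hρ2, hρ3⟩ :=
    exists_probabilityMeasure_forall_integral_eq π (κ.map ι) (η.map ι) h' hg fun z δ hδ => by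
      have hlt : liftDist c (κ z) (η z) < ENNReal.ofReal (g z + δ) :=
        (hle z).trans_lt ((ENNReal.ofReal_lt_ofReal_iff (by linarith [hg0 z])).2 (by linarith))
      obtain ⟨_, ⟨ρ, hρ, rfl⟩, hρlt⟩ := sInf_lt_iff.1 hlt
      refine ⟨ρ.map (Prod.map ι ι), ⟨?_, ?_⟩, fun n => ?_⟩
      · rw [Kernel.map_apply _ hιm.measurable, ← hρ.1,
          Measure.map_map measurable_fst hjm.measurable, Measure.map_map hιm.measurable
          measurable_fst]
        rfl
      · rw [Kernel.map_apply _ hιm.measurable, ← hρ.2,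
          Measure.map_map measurable_snd hjm.measurable, Measure.map_map hιm.measurable
          measurable_snd]
        rfl
      · rw [hjm.integral_map]
        change ∫ p, h n (Prod.map ι ι p) ∂ρ ≤ _
        rw [integral_eq_lintegral_of_nonneg_ae (.of_forall fun p => hh0 n _)
          ((h' n).continuous.comp hj.continuous).stronglyMeasurable.aestronglyMeasurable]
        refine ENNReal.toReal_le_of_le_ofReal (by linarith [hg0 z]) (le_trans ?_ hρlt.le)
        exact lintegral_mono fun p => ENNReal.ofReal_le_ofReal (hhle n p)
  simp only [ProbabilityMeasure.coe_mk] at hρ1 hρ2 hρ3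
  have hfst : ρ.map Prod.fst = (π.bind κ).map ι := by
    have := Measure.isProbabilityMeasure_map (μ := ρ)
      (measurable_fst (α := ℕ → unitInterval) (β := ℕ → unitInterval)).aemeasurable
    refine hbind κ _ fun φ => ?_
    rw [← hρ1, integral_map measurable_fst.aemeasurable
      φ.continuous.stronglyMeasurable.aestronglyMeasurable]
  have hsnd : ρ.map Prod.snd = (π.bind η).map ι := by
    have := Measure.isProbabilityMeasure_map (μ := ρ)
      (measurable_snd (α := ℕ → unitInterval) (β := ℕ → unitInterval)).aemeasurable
    refine hbind η _ fun φ => ?_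
    rw [← hρ2, integral_map measurable_snd.aemeasurable
      φ.continuous.stronglyMeasurable.aestronglyMeasurable]
  have hrange : ∀ᵐ q ∂ρ, q ∈ Set.range (Prod.map ι ι) := by
    have hmem (ξ : Kernel Z X) : ∀ᵐ q ∂(π.bind ξ).map ι, q ∈ Set.range ι :=
      hιm.ae_map_iff.2 (.of_forall Set.mem_range_self)
    have h1 := ae_of_ae_map measurable_fst.aemeasurable (hfst ▸ hmem κ)
    have h2 := ae_of_ae_map measurable_snd.aemeasurable (hsnd ▸ hmem η)
    filter_upwards [h1, h2] with q hq1 hq2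
    rw [Set.range_prodMap]
    exact ⟨hq1, hq2⟩
  have hmap : (ρ.comap (Prod.map ι ι)).map (Prod.map ι ι) = ρ := by
    rw [hjm.map_comap, Measure.restrict_eq_self_of_ae_mem hrange]
  have hinj {α β : Measure X} (hαβ : α.map ι = β.map ι) : α = β := by
    rw [← hιm.comap_map α, hαβ, hιm.comap_map]
  refine ⟨ρ.comap (Prod.map ι ι), ⟨hinj ?_, hinj ?_⟩, ?_⟩
  · rw [← hfst, Measure.map_map hιm.measurable measurable_fst]
    conv_rhs => rw [← hmap, Measure.map_map measurable_fst hjm.measurable]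
    rfl
  · rw [← hsnd, Measure.map_map hιm.measurable measurable_snd]
    conv_rhs => rw [← hmap, Measure.map_map measurable_snd hjm.measurable]
    rfl
  · have htend := lintegral_tendsto_of_tendsto_of_monotone
      (μ := ρ.comap (Prod.map ι ι))
      (f := fun n p => ENNReal.ofReal (h n (Prod.map ι ι p)))
      (fun n => ((hcont n).comp hj.continuous).measurable.ennreal_ofReal.aemeasurable)
      (.of_forall fun p m n hmn => ENNReal.ofReal_le_ofReal (hmono _ hmn))
      (.of_forall fun p => (ENNReal.continuous_ofReal.tendsto _).comp (hlim p))
    refine le_of_tendsto' htend fun n => ?_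
    rw [← hjm.lintegral_map (fun q => ENNReal.ofReal (h n q)), hmap]
    change ∫⁻ q, ENNReal.ofReal (h' n q) ∂ρ ≤ _
    rw [← ofReal_integral_eq_lintegral_ofReal ((h' n).integrable _) (.of_forall (hh0 n))]
    exact ENNReal.ofReal_le_ofReal (hρ3 n)

end Coupling

end

section Lift

variable {X : Type*} [MeasurableSpace X] {c : X → X → ℝ} {μ ν : Measure X}

theorem liftDist_const_mul {θ : ℝ} (hθ : 0 < θ) :
    liftDist (fun x y => θ * c x y) μ ν = ENNReal.ofReal θ * liftDist c μ ν := by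
  have hθ0 : ENNReal.ofReal θ ≠ 0 := by simpa using hθ
  have key (π : Measure (X × X)) : ∫⁻ p, ENNReal.ofReal (θ * c p.1 p.2) ∂π =
      ENNReal.ofReal θ * ∫⁻ p, ENNReal.ofReal (c p.1 p.2) ∂π := by
    simp_rw [ENNReal.ofReal_mul hθ.le]
    exact lintegral_const_mul' _ _ ENNReal.ofReal_ne_top
  refine le_antisymm ?_ (le_liftDist fun π hπ => ?_)
  · rw [← ENNReal.div_le_iff' hθ0 ENNReal.ofReal_ne_top]
    refine le_liftDist fun π hπ => ?_
    rw [ENNReal.div_le_iff' hθ0 ENNReal.ofReal_ne_top, ← key]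
    exact hπ.liftDist_le
  · rw [key]
    gcongr
    exact hπ.liftDist_le

theorem liftDist_mono {c' : X → X → ℝ} (h : ∀ x y, c x y ≤ c' x y) :
    liftDist c μ ν ≤ liftDist c' μ ν :=
  le_liftDist fun _ hπ => hπ.liftDist_le.trans <|
    lintegral_mono fun p => ENNReal.ofReal_le_ofReal (h p.1 p.2)

/-- Cauchy–Schwarz inequality for lifted distances. -/
theorem liftDist_sqrt_sq_le [IsProbabilityMeasure μ] [IsProbabilityMeasure ν] {V : X → ℝ}
    (hVm : Measurable V) (hV : ∀ x, 0 ≤ V x) (hc : Measurable fun p : X × X => c p.1 p.2)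
    (hc0 : ∀ x y, 0 ≤ c x y) (hμ : Integrable V μ) (hν : Integrable V ν) :
    liftDist (fun x y => √(c x y * (1 + V x + V y))) μ ν ^ 2 ≤
      ENNReal.ofReal (1 + ∫ x, V x ∂μ + ∫ x, V x ∂ν) * liftDist c μ ν := by
  have hμ0 : 0 ≤ ∫ x, V x ∂μ := integral_nonneg hV
  have hν0 : 0 ≤ ∫ x, V x ∂ν := integral_nonneg hV
  have hm0 : ENNReal.ofReal (1 + ∫ x, V x ∂μ + ∫ x, V x ∂ν) ≠ 0 := by
    rw [ne_eq, ENNReal.ofReal_eq_zero]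
    linarith
  rw [← ENNReal.div_le_iff' hm0 ENNReal.ofReal_ne_top]
  refine le_liftDist fun π hπ => ?_
  rw [ENNReal.div_le_iff' hm0 ENNReal.ofReal_ne_top]
  have hweight : ∫⁻ p, ENNReal.ofReal (1 + V p.1 + V p.2) ∂π =
      ENNReal.ofReal (1 + ∫ x, V x ∂μ + ∫ x, V x ∂ν) := by
    have := hπ.isProbabilityMeasure
    have h1 (p : X × X) : ENNReal.ofReal (1 + V p.1 + V p.2) =
        1 + ENNReal.ofReal (V p.1) + ENNReal.ofReal (V p.2) := by
      rw [ENNReal.ofReal_add (by linarith [hV p.1]) (hV _), ENNReal.ofReal_add zero_le_one (hV _),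
        ENNReal.ofReal_one]
    have hf : ∫⁻ p, ENNReal.ofReal (V p.1) ∂π = ENNReal.ofReal (∫ x, V x ∂μ) := by
      rw [ofReal_integral_eq_lintegral_ofReal hμ (.of_forall hV), ← hπ.1,
        lintegral_map hVm.ennreal_ofReal measurable_fst]
    have hs : ∫⁻ p, ENNReal.ofReal (V p.2) ∂π = ENNReal.ofReal (∫ x, V x ∂ν) := by
      rw [ofReal_integral_eq_lintegral_ofReal hν (.of_forall hV), ← hπ.2,
        lintegral_map hVm.ennreal_ofReal measurable_snd]
    simp_rw [h1]
    rw [lintegral_add_right _ (by fun_prop), lintegral_add_right _ (by fun_prop), hf, hs,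
      ENNReal.ofReal_add (by linarith) hν0, ENNReal.ofReal_add zero_le_one hμ0]
    simp
  have hhalf (x : ℝ≥0∞) : (x ^ (1 / 2 : ℝ)) ^ (2 : ℝ) = x := by
    rw [← ENNReal.rpow_mul]
    norm_num
  have hCS := ENNReal.lintegral_mul_le_Lp_mul_Lq π (p := 2) (q := 2)
    (Real.HolderConjugate.two_two)
    (f := fun p => ENNReal.ofReal (c p.1 p.2) ^ (1 / 2 : ℝ))
    (g := fun p => ENNReal.ofReal (1 + V p.1 + V p.2) ^ (1 / 2 : ℝ))
    (by fun_prop) (by fun_prop)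
  simp only [Pi.mul_apply, hhalf] at hCS
  rw [hweight, ← ENNReal.mul_rpow_of_nonneg _ _ (by norm_num)] at hCS
  have hle : liftDist (fun x y => √(c x y * (1 + V x + V y))) μ ν ≤
      ∫⁻ p, ENNReal.ofReal (c p.1 p.2) ^ (1 / 2 : ℝ) *
        ENNReal.ofReal (1 + V p.1 + V p.2) ^ (1 / 2 : ℝ) ∂π := by
    refine hπ.liftDist_le.trans_eq (lintegral_congr fun p => ?_)
    have h1 : 0 ≤ 1 + V p.1 + V p.2 := by linarith [hV p.1, hV p.2]
    rw [Real.sqrt_eq_rpow, ← ENNReal.ofReal_rpow_of_nonneg (mul_nonneg (hc0 _ _) h1) (by norm_num),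
      ENNReal.ofReal_mul (hc0 _ _), ENNReal.mul_rpow_of_nonneg _ _ (by norm_num)]
  calc _ ≤ ((_ : ℝ≥0∞) ^ (1 / 2 : ℝ)) ^ 2 := pow_le_pow_left' (hle.trans hCS) 2
    _ = _ := by rw [← ENNReal.rpow_natCast, Nat.cast_ofNat, hhalf, mul_comm]

variable [TopologicalSpace X] [PolishSpace X] [BorelSpace X]

/-- A Markov kernel which contracts the lifted distances of Dirac masses contracts the lifted
distances of all probability measures. -/
theorem liftDist_bind_le [IsProbabilityMeasure μ]
    (hc : LowerSemicontinuous fun p : X × X => c p.1 p.2) (hc0 : ∀ x y, 0 ≤ c x y)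
    (Q : Kernel X X) [IsMarkovKernel Q] {θ : ℝ} (hθ : 0 < θ)
    (hQ : ∀ x y, liftDist c (Q x) (Q y) ≤ ENNReal.ofReal (θ * c x y)) :
    liftDist c (μ.bind Q) (ν.bind Q) ≤ ENNReal.ofReal θ * liftDist c μ ν := by
  have hm : Measurable fun p : X × X => c p.1 p.2 := hc.measurable
  rw [← liftDist_const_mul hθ]
  refine le_liftDist fun π hπ => ?_
  have := hπ.isProbabilityMeasure
  by_cases hfin : ∫⁻ p, ENNReal.ofReal (θ * c p.1 p.2) ∂π = ∞
  · simp [hfin]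
  have hnn : ∀ p : X × X, 0 ≤ θ * c p.1 p.2 := fun p => mul_nonneg hθ.le (hc0 _ _)
  have hinteg : Integrable (fun p : X × X => θ * c p.1 p.2) π :=
    (lintegral_ofReal_ne_top_iff_integrable (hm.const_mul θ).aestronglyMeasurable
      (.of_forall hnn)).1 hfin
  obtain ⟨ρ, hρ, hle⟩ := exists_isCoupling_bind_lintegral_le π (Q.comap Prod.fst measurable_fst)
    (Q.comap Prod.snd measurable_snd) hc hc0 hinteg hnn fun p => hQ p.1 p.2
  rw [ofReal_integral_eq_lintegral_ofReal hinteg (.of_forall hnn)] at hle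
  have hbind (f : X × X → X) (hf : Measurable f) : π.bind (Q.comap f hf) = (π.map f).bind Q := by
    ext s hs
    rw [Measure.bind_apply hs (Kernel.aemeasurable _),
      Measure.bind_apply hs (Kernel.aemeasurable _), lintegral_map (Q.measurable_coe hs) hf]
    rfl
  rw [hbind, hbind, hπ.1, hπ.2] at hρ
  exact hρ.liftDist_le.trans hle

theorem eq_of_liftDist_eq_zero [IsProbabilityMeasure μ] [IsProbabilityMeasure ν]
    (hc : LowerSemicontinuous fun p : X × X => c p.1 p.2) (hc0 : ∀ x y, 0 ≤ c x y)
    (hc_eq : ∀ x y, c x y = 0 → x = y) (h : liftDist c μ ν = 0) : μ = ν := by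
  obtain ⟨ρ, hρ, hle⟩ := exists_isCoupling_bind_lintegral_le (Measure.dirac ())
    (Kernel.const Unit μ) (Kernel.const Unit ν) hc hc0 (integrable_zero Unit ℝ _)
    (fun _ => le_rfl) (by simp [h])
  have hbind (ξ : Measure X) : (Measure.dirac ()).bind (Kernel.const Unit ξ) = ξ := by simp
  rw [hbind, hbind] at hρ
  simp only [Pi.zero_apply, integral_zero, ENNReal.ofReal_zero, nonpos_iff_eq_zero] at hle
  rw [lintegral_eq_zero_iff hc.measurable.ennreal_ofReal] at hle
  rw [← hρ.1, ← hρ.2]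
  refine Measure.map_congr ?_
  filter_upwards [hle] with p hp
  exact hc_eq _ _ ((ENNReal.ofReal_eq_zero.1 hp).antisymm (hc0 _ _))

end Lift

section WeightedDistance

variable {X : Type*} {d : X → X → ℝ} {V : X → ℝ}

theorem LowerSemicontinuous.sqrt_mul_weight [TopologicalSpace X]
    (hd : LowerSemicontinuous fun p : X × X => d p.1 p.2) (hVc : Continuous V)
    (hV : ∀ x, 0 ≤ V x) :
    LowerSemicontinuous fun p : X × X => √(d p.1 p.2 * (1 + V p.1 + V p.2)) := by
  have hw (p : X × X) : 0 < 1 + V p.1 + V p.2 := by linarith [hV p.1, hV p.2]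
  have hmul : LowerSemicontinuous fun p : X × X => d p.1 p.2 * (1 + V p.1 + V p.2) := by
    intro p a ha
    have hcont : Continuous fun q : X × X => -(a / (1 + V q.1 + V q.2)) :=
      (Continuous.div (by fun_prop) (by fun_prop) fun q => (hw q).ne').neg
    have hpos : 0 < d p.1 p.2 + -(a / (1 + V p.1 + V p.2)) := by
      have := (div_lt_iff₀ (hw p)).2 ha
      linarith
    filter_upwards [(hd.add hcont.lowerSemicontinuous) p 0 hpos] with q hq
    exact (div_lt_iff₀ (hw q)).1 (by linarith)
  exact Real.continuous_sqrt.comp_lowerSemicontinuous hmul Real.sqrt_monotone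

variable [MeasurableSpace X]

theorem liftDist_le_one {μ ν : Measure X} [IsProbabilityMeasure μ] [IsProbabilityMeasure ν]
    (hd1 : ∀ x y, d x y ≤ 1) : liftDist d μ ν ≤ 1 := by
  refine (isCoupling_prod μ ν).liftDist_le.trans ?_
  calc _ ≤ ∫⁻ _, 1 ∂(μ.prod ν) :=
        lintegral_mono fun p => by simpa using! ENNReal.ofReal_le_ofReal (hd1 p.1 p.2)
    _ = 1 := by simp

variable [TopologicalSpace X] [PolishSpace X] [BorelSpace X]

/-- One step of the weak Harris theorem: if `Q` contracts `d` and `V` is a Lyapunov function of `Q`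
whose level set `{V ≤ 4 K}` is `d`-small, then `Q` contracts a weighted version of `d`. -/
theorem exists_liftDist_sqrt_le (Q : Kernel X X) [IsMarkovKernel Q]
    (hd : LowerSemicontinuous fun p : X × X => d p.1 p.2) (hd0 : ∀ x y, 0 ≤ d x y)
    (hd1 : ∀ x y, d x y ≤ 1) (hVc : Continuous V) (hV : ∀ x, 0 ≤ V x)
    (hVint : ∀ x, Integrable V (Q x)) {K : ℝ} (hK : 0 < K)
    (hLyap : ∀ x, ∫ y, V y ∂(Q x) ≤ V x / 4 + K) {a : ℝ} (ha0 : 0 < a) (ha1 : a < 1)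
    (hcontr : ∀ x y, d x y < 1 → liftDist d (Q x) (Q y) ≤ ENNReal.ofReal (a * d x y))
    (hsmall : ∀ x y, V x ≤ 4 * K → V y ≤ 4 * K → liftDist d (Q x) (Q y) ≤ ENNReal.ofReal a) :
    ∃ β θ : ℝ, 0 < β ∧ β ≤ 1 ∧ 0 < θ ∧ θ < 1 ∧ ∀ x y,
      liftDist (fun x y => √(d x y * (1 + β * V x + β * V y))) (Q x) (Q y) ≤
        ENNReal.ofReal (θ * √(d x y * (1 + β * V x + β * V y))) := by
  obtain ⟨β, hβ0, hβ1, hβK⟩ : ∃ β : ℝ, 0 < β ∧ β ≤ 1 ∧ β * K ≤ (1 - a) / 4 := by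
    refine ⟨(1 - a) / (4 * (K + 1)), div_pos (by linarith) (by linarith), ?_, ?_⟩
    · rw [div_le_one (by linarith)]
      linarith
    · rw [div_mul_eq_mul_div, div_le_div_iff₀ (by linarith) (by norm_num)]
      nlinarith
  set b := β * K with hb
  have hb0 : 0 < b := mul_pos hβ0 hK
  set r := max ((1 + a) / 2) ((1 + 3 * b) / (1 + 4 * b)) with hr
  have hr0 : 0 < r := lt_max_of_lt_left (by linarith)
  have hr1 : r < 1 := max_lt (by linarith) (by rw [div_lt_one (by linarith)]; linarith)
  refine ⟨β, √r, hβ0, hβ1, Real.sqrt_pos.2 hr0, (Real.sqrt_lt' one_pos).2 (by simpa using hr1),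
    fun x y => ?_⟩
  have hx := hV x
  have hy := hV y
  have hux : 0 ≤ β * V x := by positivity
  have huy : 0 ≤ β * V y := by positivity
  have hLx : β * ∫ z, V z ∂(Q x) ≤ β * V x / 4 + b := by
    calc _ ≤ β * (V x / 4 + K) := by gcongr; exact hLyap x
      _ = _ := by ring
  have hLy : β * ∫ z, V z ∂(Q y) ≤ β * V y / 4 + b := by
    calc _ ≤ β * (V y / 4 + K) := by gcongr; exact hLyap y
      _ = _ := by ring
  have hfirst : (1 + (β * V x + β * V y) / 4 + 2 * b) * a ≤ r * (1 + β * V x + β * V y) := by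
    have h1 : (1 + 2 * b) * a ≤ r := le_trans (by nlinarith) (le_max_left _ _)
    calc _ ≤ (1 + 2 * b) * a * (1 + β * V x + β * V y) := by
          have := mul_nonneg (add_nonneg hux huy) ha0.le
          have := mul_nonneg this hb0.le
          nlinarith
      _ ≤ _ := mul_le_mul_of_nonneg_right h1 (by linarith)
  obtain ⟨w, hw, hwle⟩ : ∃ w, liftDist d (Q x) (Q y) ≤ ENNReal.ofReal w ∧
      (1 + (β * V x + β * V y) / 4 + 2 * b) * w ≤ r * (d x y * (1 + β * V x + β * V y)) := by
    rcases (hd1 x y).lt_or_eq with hlt | heq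
    · refine ⟨_, hcontr x y hlt, ?_⟩
      nlinarith [mul_le_mul_of_nonneg_right hfirst (hd0 x y)]
    rw [heq, one_mul]
    by_cases hxy : V x ≤ 4 * K ∧ V y ≤ 4 * K
    · exact ⟨a, hsmall x y hxy.1 hxy.2, hfirst⟩
    · refine ⟨1, by simpa using liftDist_le_one hd1, ?_⟩
      have hlarge : 4 * b ≤ β * V x + β * V y := by
        have : 4 * K ≤ V x + V y := by
          by_contra! hcon
          exact hxy ⟨by linarith, by linarith⟩
        nlinarith
      calc _ ≤ (1 + 3 * b) / (1 + 4 * b) * (1 + β * V x + β * V y) := by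
            rw [div_mul_eq_mul_div, le_div_iff₀ (by linarith)]
            nlinarith
        _ ≤ _ := by
            gcongr
            exact le_max_right _ _
  have hCS := liftDist_sqrt_sq_le (μ := Q x) (ν := Q y) (c := d) (V := fun z => β * V z)
    (hVc.measurable.const_mul β) (fun z => mul_nonneg hβ0.le (hV z)) hd.measurable hd0
    ((hVint x).const_mul β) ((hVint y).const_mul β)
  simp only [integral_const_mul] at hCS
  rw [← ENNReal.pow_le_pow_left_iff two_ne_zero, ← ENNReal.ofReal_pow (by positivity)]
  have hc0 : 0 ≤ d x y * (1 + β * V x + β * V y) := mul_nonneg (hd0 x y) (by linarith)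
  rw [mul_pow, Real.sq_sqrt hr0.le, Real.sq_sqrt hc0]
  refine hCS.trans ?_
  calc _ ≤ ENNReal.ofReal (1 + (β * V x + β * V y) / 4 + 2 * b) * ENNReal.ofReal w :=
        mul_le_mul' (ENNReal.ofReal_le_ofReal (by linarith)) hw
    _ ≤ _ := by
        rw [← ENNReal.ofReal_mul (by linarith)]
        exact ENNReal.ofReal_le_ofReal hwle

end WeightedDistance

section Semigroup

variable {X : Type*} [MeasurableSpace X] {P : ℝ≥0 → Kernel X X} [∀ t, IsMarkovKernel (P t)]

theorem liftDist_bind_nsmul_le (hP : ∀ s t, P (s + t) = P t ∘ₖ P s) {c : X → X → ℝ}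
    {θ : ℝ≥0∞} {T : ℝ≥0}
    (hT : ∀ μ ν : Measure X, IsProbabilityMeasure μ → IsProbabilityMeasure ν →
      liftDist c (μ.bind (P T)) (ν.bind (P T)) ≤ θ * liftDist c μ ν)
    (μ ν : Measure X) [IsProbabilityMeasure μ] [IsProbabilityMeasure ν] (n : ℕ) :
    liftDist c (μ.bind (P ((n + 1) • T))) (ν.bind (P ((n + 1) • T))) ≤
      θ ^ (n + 1) * liftDist c μ ν := by
  induction n with
  | zero => simpa using hT μ ν inferInstance inferInstance
  | succ n ih =>
    rw [succ_nsmul, hP, ← Measure.comp_assoc, ← Measure.comp_assoc, pow_succ', mul_assoc]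
    refine (hT _ _ inferInstance inferInstance).trans ?_
    gcongr

theorem integrable_of_invariant {V : X → ℝ} (hVm : Measurable V) (hV : ∀ x, 0 ≤ V x)
    (hVint : ∀ t x, Integrable V (P t x)) {C γ K : ℝ} (hγ : 0 < γ)
    (hLyap : ∀ (t : ℝ≥0) x, ∫ y, V y ∂(P t x) ≤ C * Real.exp (-γ * t) * V x + K)
    {μ : Measure X} [IsProbabilityMeasure μ] (hμ : ∀ t, (P t).Invariant μ) : Integrable V μ := by
  have hexp : Tendsto (fun n : ℕ => Real.exp (-γ * ((n : ℝ≥0) : ℝ))) atTop (𝓝 0) := by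
    refine Real.tendsto_exp_atBot.comp ?_
    simp only [NNReal.coe_natCast, neg_mul]
    exact tendsto_neg_atTop_atBot.comp (tendsto_natCast_atTop_atTop.const_mul_atTop hγ)
  have htrunc (M : ℕ) : ∫⁻ x, min (ENNReal.ofReal (V x)) M ∂μ ≤ ENNReal.ofReal K := by
    have hstep (n : ℕ) : ∫⁻ x, min (ENNReal.ofReal (V x)) M ∂μ ≤
        ∫⁻ x, min (ENNReal.ofReal (C * Real.exp (-γ * ((n : ℝ≥0) : ℝ)) * V x + K)) M ∂μ := by
      conv_lhs => rw [← hμ n]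
      rw [Measure.lintegral_bind (Kernel.aemeasurable _) (by fun_prop)]
      refine lintegral_mono fun x => le_min ?_ ?_
      · calc _ ≤ ∫⁻ y, ENNReal.ofReal (V y) ∂(P n x) := lintegral_mono fun y => min_le_left _ _
          _ = ENNReal.ofReal (∫ y, V y ∂(P n x)) :=
            (ofReal_integral_eq_lintegral_ofReal (hVint n x) (.of_forall hV)).symm
          _ ≤ _ := ENNReal.ofReal_le_ofReal (hLyap n x)
      · calc _ ≤ ∫⁻ _, (M : ℝ≥0∞) ∂(P n x) := lintegral_mono fun y => min_le_right _ _
          _ = M := by simp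
    have hlim : Tendsto (fun n : ℕ =>
        ∫⁻ x, min (ENNReal.ofReal (C * Real.exp (-γ * ((n : ℝ≥0) : ℝ)) * V x + K)) M ∂μ) atTop
        (𝓝 (∫⁻ _, min (ENNReal.ofReal K) M ∂μ)) := by
      refine tendsto_lintegral_of_dominated_convergence (fun _ => (M : ℝ≥0∞)) (fun n => by fun_prop)
        (fun n => .of_forall fun x => min_le_right _ _) (by simp) (.of_forall fun x => ?_)
      refine ((ENNReal.continuous_ofReal.tendsto K).comp ?_).min tendsto_const_nhds
      simpa using ((hexp.const_mul C).mul_const (V x)).add_const K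
    refine (ge_of_tendsto' hlim hstep).trans ?_
    simp
  refine (lintegral_ofReal_ne_top_iff_integrable hVm.aestronglyMeasurable (.of_forall hV)).1 ?_
  refine ne_top_of_le_ne_top (ENNReal.ofReal_ne_top (r := K)) ?_
  have hsup : Tendsto (fun M : ℕ => ∫⁻ x, min (ENNReal.ofReal (V x)) M ∂μ) atTop
      (𝓝 (∫⁻ x, ENNReal.ofReal (V x) ∂μ)) := by
    refine lintegral_tendsto_of_tendsto_of_monotone (fun M => by fun_prop)
      (.of_forall fun x m n hmn => min_le_min_left _ (mod_cast hmn)) (.of_forall fun x => ?_)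
    simpa using (tendsto_const_nhds (x := ENNReal.ofReal (V x))).min ENNReal.tendsto_nat_nhds_top
  exact le_of_tendsto' hsup htrunc

end Semigroup

/-- **Theorem 4.8 (weak Harris theorem).** If a Markov semigroup over a Polish space has a
continuous Lyapunov function `V`, and a distance-like function `d : X×X → [0,1]` which is
contracting for `P_{t★}` and for which the level set `{V ≤ 4 K_V}` is `d`-small, then there
is at most one invariant probability measure, and the lifted distance
`d̃(x,y) = √(d(x,y)(1 + V(x) + V(y)))` is contracted by a factor `1/2` by `P_t` for some
`t > 0`. -/
theorem stmt_6 {X : Type*} [MetricSpace X] [CompleteSpace X] [SecondCountableTopology X]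
    [MeasurableSpace X] [BorelSpace X]
    (P : ℝ≥0 → Kernel X X) [∀ t, IsMarkovKernel (P t)]
    (hsemi : ∀ s t : ℝ≥0, P (s + t) = (P t) ∘ₖ (P s))
    (V : X → ℝ) (hVcont : Continuous V) (hVnonneg : ∀ x, 0 ≤ V x)
    (hVint : ∀ (t : ℝ≥0) (x : X), Integrable V ((P t) x))
    (C_V γ K_V : ℝ) (hC_V : 0 < C_V) (hγ : 0 < γ) (hK_V : 0 < K_V)
    (hLyap : ∀ (t : ℝ≥0) (x : X),
      ∫ y, V y ∂((P t) x) ≤ C_V * Real.exp (-γ * t) * V x + K_V)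
    (tstar : ℝ≥0) (htstar : 0 < tstar)
    -- `d` is a distance-like function with values in `[0,1]`
    (d : X → X → ℝ)
    (hd_symm : ∀ x y, d x y = d y x)
    (hd_eq_zero : ∀ x y, d x y = 0 ↔ x = y)
    (hd_lsc : LowerSemicontinuous (fun p : X × X => d p.1 p.2))
    (hd_nonneg : ∀ x y, 0 ≤ d x y) (hd_le_one : ∀ x y, d x y ≤ 1)
    -- `d` is contracting for `P_{t★}`
    (hcontract : ∃ α : ℝ, α < 1 ∧ ∀ x y, d x y < 1 →
      liftDist d ((P tstar) x) ((P tstar) y) ≤ ENNReal.ofReal (α * d x y))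
    -- the level set `{V ≤ 4 K_V}` is `d`-small for `P_{t★}`
    (hsmall : ∃ ε : ℝ, 0 < ε ∧ ∀ x, V x ≤ 4 * K_V → ∀ y, V y ≤ 4 * K_V →
      liftDist d ((P tstar) x) ((P tstar) y) ≤ ENNReal.ofReal (1 - ε)) :
    (∀ μ ν : Measure X, IsProbabilityMeasure μ → IsProbabilityMeasure ν →
      (∀ t : ℝ≥0, (P t).Invariant μ) → (∀ t : ℝ≥0, (P t).Invariant ν) → μ = ν) ∧
    ∃ t : ℝ≥0, 0 < t ∧ ∀ μ ν : Measure X, IsProbabilityMeasure μ → IsProbabilityMeasure ν →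
      liftDist (fun x y => Real.sqrt (d x y * (1 + V x + V y)))
          (μ.bind (fun x => (P t) x)) (ν.bind (fun x => (P t) x))
        ≤ (1 / 2) * liftDist (fun x y => Real.sqrt (d x y * (1 + V x + V y))) μ ν := by
  let dV : X → X → ℝ := fun x y => √(d x y * (1 + V x + V y))
  have hcontraction : ∃ t : ℝ≥0, 0 < t ∧ ∀ μ ν : Measure X, IsProbabilityMeasure μ →
      IsProbabilityMeasure ν →
      liftDist dV (μ.bind (P t)) (ν.bind (P t)) ≤ (1 / 2) * liftDist dV μ ν := by
    obtain ⟨α, hα, hcontract⟩ := hcontract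
    obtain ⟨ε, hε, hsmall⟩ := hsmall
    obtain ⟨a, ha0, ha1, hαa, hεa⟩ : ∃ a : ℝ, 0 < a ∧ a < 1 ∧ α ≤ a ∧ 1 - ε ≤ a :=
      ⟨max (max α (1 - ε)) (1 / 2), lt_max_of_lt_right (by norm_num),
        max_lt (max_lt hα (by linarith)) (by norm_num), by simp, by simp⟩
    have hcontr (x y : X) (hxy : d x y < 1) :
        liftDist d (P tstar x) (P tstar y) ≤ ENNReal.ofReal (a * d x y) :=
      (hcontract x y hxy).trans
        (ENNReal.ofReal_le_ofReal (mul_le_mul_of_nonneg_right hαa (hd_nonneg x y)))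
    have hnonexp (μ ν : Measure X) (_ : IsProbabilityMeasure μ) (_ : IsProbabilityMeasure ν) :
        liftDist d (μ.bind (P tstar)) (ν.bind (P tstar)) ≤ 1 * liftDist d μ ν := by
      have := liftDist_bind_le (μ := μ) (ν := ν) hd_lsc hd_nonneg (P tstar) one_pos fun x y => by
        rw [one_mul]
        rcases (hd_le_one x y).lt_or_eq with hlt | heq
        · exact (hcontr x y hlt).trans (ENNReal.ofReal_le_ofReal
            (mul_le_of_le_one_left (hd_nonneg x y) ha1.le))
        · simpa [heq] using liftDist_le_one hd_le_one
      simpa using this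
    obtain ⟨m, hm⟩ : ∃ m : ℕ,
        C_V * Real.exp (-γ * ((tstar + (m + 1) • tstar : ℝ≥0) : ℝ)) ≤ 1 / 4 := by
      have hlim : Tendsto (fun m : ℕ =>
          C_V * Real.exp (-γ * ((tstar + (m + 1) • tstar : ℝ≥0) : ℝ))) atTop (𝓝 (C_V * 0)) := by
        refine (Real.tendsto_exp_atBot.comp ?_).const_mul C_V
        refine (tendsto_atTop_mono (fun m => ?_) (tendsto_natCast_atTop_atTop.atTop_mul_const
          (NNReal.coe_pos.2 htstar))).const_mul_atTop_of_neg (neg_lt_zero.2 hγ)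
        have := tstar.coe_nonneg
        push_cast [nsmul_eq_mul]
        nlinarith
      rw [mul_zero] at hlim
      exact (hlim.eventually_le_const (by norm_num)).exists
    set T : ℝ≥0 := tstar + (m + 1) • tstar with hT
    have hle (x y : X) : liftDist d (P T x) (P T y) ≤ liftDist d (P tstar x) (P tstar y) := by
      have := liftDist_bind_nsmul_le hsemi hnonexp (P tstar x) (P tstar y) m
      rwa [one_pow, one_mul, ← Kernel.comp_apply, ← Kernel.comp_apply, ← hsemi] at this
    obtain ⟨β, θ, hβ0, hβ1, hθ0, hθ1, hβ⟩ := exists_liftDist_sqrt_le (P T) hd_lsc hd_nonneg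
      hd_le_one hVcont hVnonneg (hVint T) hK_V
      (fun x => (hLyap T x).trans (by nlinarith [hVnonneg x])) ha0 ha1
      (fun x y hxy => (hle x y).trans (hcontr x y hxy))
      (fun x y hx hy => (hle x y).trans
        ((hsmall x hx y hy).trans (ENNReal.ofReal_le_ofReal hεa)))
    obtain ⟨n, hn⟩ := exists_pow_lt_of_lt_one (div_pos (Real.sqrt_pos.2 hβ0) two_pos) hθ1
    refine ⟨(n + 1) • T, by positivity, fun μ ν hμ hν => ?_⟩
    let dβ : X → X → ℝ := fun x y => √(d x y * (1 + β * V x + β * V y))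
    have hiter := liftDist_bind_nsmul_le hsemi (c := dβ) (fun μ ν _ _ => liftDist_bind_le
      (hd_lsc.sqrt_mul_weight (hVcont.const_mul β) fun x => mul_nonneg hβ0.le (hVnonneg x))
      (fun _ _ => Real.sqrt_nonneg _) (P T) hθ0 hβ) μ ν n
    have hlower (x y : X) : √β * dV x y ≤ dβ x y := by
      rw [← Real.sqrt_mul hβ0.le]
      refine Real.sqrt_le_sqrt ?_
      nlinarith [hd_nonneg x y]
    have hupper (x y : X) : dβ x y ≤ dV x y := by
      refine Real.sqrt_le_sqrt (mul_le_mul_of_nonneg_left ?_ (hd_nonneg x y))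
      nlinarith [hVnonneg x, hVnonneg y]
    have hβs : ENNReal.ofReal √β ≠ 0 := by simpa using hβ0
    rw [← ENNReal.mul_le_mul_iff_right hβs ENNReal.ofReal_ne_top,
      ← liftDist_const_mul (Real.sqrt_pos.2 hβ0)]
    calc _ ≤ liftDist dβ (μ.bind (P ((n + 1) • T))) (ν.bind (P ((n + 1) • T))) :=
          liftDist_mono hlower
      _ ≤ ENNReal.ofReal θ ^ (n + 1) * liftDist dβ μ ν := hiter
      _ ≤ ENNReal.ofReal (√β / 2) * liftDist dV μ ν := by
          refine mul_le_mul' ?_ (liftDist_mono hupper)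
          rw [← ENNReal.ofReal_pow hθ0.le]
          exact ENNReal.ofReal_le_ofReal
            ((pow_le_pow_of_le_one hθ0.le hθ1.le n.le_succ).trans hn.le)
      _ = _ := by
          rw [ENNReal.ofReal_div_of_pos two_pos, ← mul_assoc, one_div, div_eq_mul_inv,
            ENNReal.ofReal_ofNat]
  refine ⟨fun μ ν hμ hν hPμ hPν => ?_, hcontraction⟩
  obtain ⟨t, -, ht⟩ := hcontraction
  have hle := ht μ ν hμ hν
  rw [hPμ t, hPν t] at hle
  have hfin : liftDist dV μ ν ≠ ∞ := by
    have hCS := liftDist_sqrt_sq_le hVcont.measurable hVnonneg hd_lsc.measurable hd_nonneg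
      (integrable_of_invariant hVcont.measurable hVnonneg hVint hγ hLyap hPμ)
      (integrable_of_invariant hVcont.measurable hVnonneg hVint hγ hLyap hPν)
    exact ((ENNReal.pow_lt_top_iff (n := 2)).1 (hCS.trans_lt (ENNReal.mul_lt_top
      ENNReal.ofReal_lt_top ((liftDist_le_one hd_le_one).trans_lt ENNReal.one_lt_top)))
      |>.resolve_right two_ne_zero).ne
  have hzero : liftDist dV μ ν = 0 := by
    by_contra hne
    refine (ENNReal.half_lt_self hne hfin).not_ge ?_
    rwa [ENNReal.div_eq_inv_mul, ← one_div]
  refine eq_of_liftDist_eq_zero (hd_lsc.sqrt_mul_weight hVcont hVnonneg)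
    (fun _ _ => Real.sqrt_nonneg _) (fun x y hxy => ?_) hzero
  have hw : 0 < 1 + V x + V y := by linarith [hVnonneg x, hVnonneg y]
  rw [Real.sqrt_eq_zero (mul_nonneg (hd_nonneg x y) hw.le)] at hxy
  exact (hd_eq_zero x y).1 ((mul_eq_zero.1 hxy).resolve_right hw.ne')
end
end
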